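/- arXiv:1803.00241 — 8 statements merged into one kernel-verified Lean document; each statement's English description precedes it below -/
import Mathlib

section
/- Let $a \in \mathbb{R}$, $0 < s < 1$, $1 \le p < \infty$ and $n \ge 2$ be such that $(s-a)p < n$. Then there exists a constant $C > 0$, depending only on $a, s, p, n$, such that for every measurable function $f : \partial B \to \mathbb{R}$ one has $\|U_a f\|_{L^p(B)}^p + \int_B \int_B \frac{|U_a f(X) - U_a f(Y)|^p}{|X-Y|^{n+sp}}\, dX\, dY \le C \left( \int_{\partial B} |f|^p \, d\sigma + \int_{\partial B}\int_{\partial B} \frac{|f(x)-f(y)|^p}{|x-y|^{n-1+sp}}\, d\sigma(x)\, d\sigma(y) \right)$, where both sides are interpreted as values in $[0, \infty]$. -/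
open MeasureTheory Metric
open Set Filter Topology Module
open scoped ENNReal NNReal Pointwise

section Haar

variable {E : Type*} [NormedAddCommGroup E] [NormedSpace ℝ E] [FiniteDimensional ℝ E]
  [MeasurableSpace E] [BorelSpace E] (μ : Measure E) [μ.IsAddHaarMeasure]

lemma toSphere_closedBall_le {δ : ℝ} (hδ : 0 < δ) (hδ1 : δ ≤ 1) (x : sphere (0 : E) 1) :
    μ.toSphere (closedBall x δ) ≤
      ENNReal.ofReal (finrank ℝ E * 2 ^ (finrank ℝ E + 1) * μ.real (ball 0 1)) *
        ENNReal.ofReal δ ^ ((finrank ℝ E : ℝ) - 1) := by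
  set d := finrank ℝ E with hd
  set N := ⌈1 / δ⌉₊
  have hN1 : 1 / δ ≤ N := Nat.le_ceil _
  have hN2 : (N : ℝ) ≤ 2 / δ := by
    have h1 := (Nat.ceil_lt_add_one (a := 1 / δ) (by positivity)).le
    have h2 : 1 ≤ 1 / δ := by rw [le_div_iff₀ hδ]; linarith
    calc (N : ℝ) ≤ 1 / δ + 1 := h1
      _ ≤ 1 / δ + 1 / δ := by linarith
      _ = 2 / δ := by ring
  have hNpos : (0 : ℝ) < N := lt_of_lt_of_le (by positivity) hN1
  have hx : ‖(x : E)‖ = 1 := by simp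
  have hsub : Ioo (0 : ℝ) 1 • ((↑) '' closedBall x δ : Set E) ⊆
      ⋃ k ∈ Finset.range N, closedBall (((k : ℝ) / N) • (x : E)) (2 * δ) := by
    rintro _ ⟨t, ht, _, ⟨z, hz, rfl⟩, rfl⟩
    have htN : 0 ≤ t * N := mul_nonneg ht.1.le hNpos.le
    have hk1 := Nat.floor_le htN
    have hk2 := Nat.lt_floor_add_one (t * N)
    simp only [mem_iUnion, Finset.mem_range, exists_prop]
    refine ⟨⌊t * N⌋₊, ?_, ?_⟩
    · rw [Nat.floor_lt htN]
      nlinarith [ht.2]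
    · have hzx : ‖(z : E) - x‖ ≤ δ := by
        have := mem_closedBall.1 hz
        rwa [Subtype.dist_eq, dist_eq_norm] at this
      have hk : |t - (⌊t * N⌋₊ : ℝ) / N| ≤ δ := by
        have h1 : t - (⌊t * N⌋₊ : ℝ) / N = (t * N - ⌊t * N⌋₊) / N := by
          field_simp
        rw [h1, abs_of_nonneg (div_nonneg (by linarith) hNpos.le), div_le_iff₀ hNpos]
        rw [div_le_iff₀ hδ] at hN1
        linarith
      rw [mem_closedBall, dist_eq_norm]
      calc ‖t • (z : E) - ((⌊t * N⌋₊ : ℝ) / N) • (x : E)‖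
          = ‖t • ((z : E) - x) + (t - (⌊t * N⌋₊ : ℝ) / N) • (x : E)‖ := by
            congr 1; module
        _ ≤ |t| * ‖(z : E) - x‖ + |t - (⌊t * N⌋₊ : ℝ) / N| * ‖(x : E)‖ := by
            simpa only [norm_smul, Real.norm_eq_abs] using
              norm_add_le (t • ((z : E) - x)) ((t - (⌊t * N⌋₊ : ℝ) / N) • (x : E))
        _ ≤ 1 * δ + δ * 1 := by
            gcongr
            · rw [abs_of_pos ht.1]; exact ht.2.le
            · exact hx.le
        _ = 2 * δ := by ring
  rw [μ.toSphere_apply' isClosed_closedBall.measurableSet,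
    ENNReal.ofReal_rpow_of_pos hδ, ← ENNReal.ofReal_mul (by positivity)]
  calc (d : ℝ≥0∞) * μ (Ioo (0 : ℝ) 1 • ((↑) '' closedBall x δ : Set E))
      ≤ d * ∑ k ∈ Finset.range N, μ (closedBall (((k : ℝ) / N) • (x : E)) (2 * δ)) := by
        gcongr
        exact (measure_mono hsub).trans (measure_biUnion_finset_le _ _)
    _ = ENNReal.ofReal (d * (N * ((2 * δ) ^ d * μ.real (ball 0 1)))) := by
        simp_rw [μ.addHaar_closedBall _ (by positivity : 0 ≤ 2 * δ)]
        rw [ENNReal.ofReal_mul (by positivity), ENNReal.ofReal_mul (by positivity),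
          ENNReal.ofReal_mul (by positivity), Measure.real,
          ENNReal.ofReal_toReal measure_ball_lt_top.ne]
        simp [hd]
    _ ≤ _ := by
        refine ENNReal.ofReal_le_ofReal ?_
        calc d * (N * ((2 * δ) ^ d * μ.real (ball 0 1)))
            ≤ d * (2 / δ * ((2 * δ) ^ d * μ.real (ball 0 1))) := by gcongr
          _ = _ := by
            rw [Real.rpow_sub hδ, Real.rpow_natCast, Real.rpow_one]
            field_simp
            ring

lemma toSphere_le_smul_hausdorffMeasure (hd : 2 ≤ finrank ℝ E) :
    ∃ C : ℝ≥0, μ.toSphere ≤ C • (μH[(finrank ℝ E : ℝ) - 1] : Measure (sphere (0 : E) 1)) := by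
  set d := finrank ℝ E
  have hd1 : 0 < (d : ℝ) - 1 := by
    have : (2 : ℝ) ≤ d := by exact_mod_cast hd
    linarith
  set c : ℝ := d * 2 ^ (d + 1) * μ.real (ball 0 1)
  have hc0 : 0 < c := by
    have : 0 < μ.real (ball (0 : E) 1) :=
      ENNReal.toReal_pos (measure_ball_pos μ 0 one_pos).ne' measure_ball_lt_top.ne
    positivity
  have hball : ∀ (x : sphere (0 : E) 1) (δ : ℝ), 0 ≤ δ → δ ≤ 1 →
      μ.toSphere (closedBall x δ) ≤ ENNReal.ofReal c * ENNReal.ofReal δ ^ ((d : ℝ) - 1) := by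
    intro x δ h0 h1
    rcases h0.eq_or_lt with rfl | h0
    · have hlim : Tendsto (fun ε : ℝ ↦ ENNReal.ofReal c * ENNReal.ofReal ε ^ ((d : ℝ) - 1))
          (𝓝[>] 0) (𝓝 (ENNReal.ofReal c * ENNReal.ofReal 0 ^ ((d : ℝ) - 1))) := by
        refine Tendsto.mono_left ?_ nhdsWithin_le_nhds
        refine ENNReal.Tendsto.const_mul ?_ (Or.inr ENNReal.ofReal_ne_top)
        exact (ENNReal.continuous_rpow_const.comp ENNReal.continuous_ofReal).tendsto 0
      refine ge_of_tendsto hlim ?_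
      filter_upwards [Ioc_mem_nhdsGT (zero_lt_one' ℝ)] with ε hε
      exact (measure_mono (closedBall_subset_closedBall hε.1.le)).trans
        (toSphere_closedBall_le μ hε.1 hε.2 x)
    · exact toSphere_closedBall_le μ h0 h1 x
  have hcE : ENNReal.ofReal c ≠ 0 := by simpa using hc0
  have key : (ENNReal.ofReal c)⁻¹ • μ.toSphere ≤
      (μH[(d : ℝ) - 1] : Measure (sphere (0 : E) 1)) := by
    refine Measure.le_hausdorffMeasure _ _ 1 one_pos fun s hs ↦ ?_
    rcases s.eq_empty_or_nonempty with rfl | ⟨x, hx⟩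
    · simp
    have htop : ediam s ≠ ∞ := ne_top_of_le_ne_top ENNReal.one_ne_top hs
    have hsub : s ⊆ closedBall x (diam s) := fun y hy ↦
      mem_closedBall.2 (dist_le_diam_of_mem' htop hy hx)
    have h1 : diam s ≤ 1 := ENNReal.toReal_le_of_le_ofReal zero_le_one (by simpa using hs)
    rw [Measure.smul_apply, smul_eq_mul, mul_comm, ← div_eq_mul_inv]
    refine ENNReal.div_le_of_le_mul' ((measure_mono hsub).trans ?_)
    refine (hball x _ diam_nonneg h1).trans_eq ?_
    rw [diam, ENNReal.ofReal_toReal htop]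
  refine ⟨c.toNNReal, Measure.le_iff.2 fun s _ ↦ ?_⟩
  have := key s
  rw [Measure.smul_apply, smul_eq_mul, mul_comm, ← div_eq_mul_inv,
    ENNReal.div_le_iff_le_mul (Or.inl hcE) (Or.inl ENNReal.ofReal_ne_top), mul_comm] at this
  exact this

lemma lintegral_toSphere_le_hausdorffMeasure (hd : 2 ≤ finrank ℝ E) :
    ∃ C : ℝ≥0, ∀ g : E → ℝ≥0∞, ∫⁻ x, g x ∂μ.toSphere ≤
      C * ∫⁻ x in sphere (0 : E) 1, g x ∂μH[(finrank ℝ E : ℝ) - 1] := by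
  obtain ⟨C, hC⟩ := toSphere_le_smul_hausdorffMeasure μ hd
  refine ⟨C, fun g ↦ ?_⟩
  have hd1 : 0 ≤ (finrank ℝ E : ℝ) - 1 := by
    have : (2 : ℝ) ≤ finrank ℝ E := by exact_mod_cast hd
    linarith
  have hmap := (isometry_subtype_coe (s := sphere (0 : E) 1)).map_hausdorffMeasure
    (d := (finrank ℝ E : ℝ) - 1) (Or.inl hd1)
  rw [Subtype.range_coe] at hmap
  rw [← hmap, (MeasurableEmbedding.subtype_coe isClosed_sphere.measurableSet).lintegral_map]
  refine (lintegral_mono' hC le_rfl).trans_eq ?_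
  rw [lintegral_smul_measure]
  rfl

/-- Integration in polar coordinates. -/
lemma lintegral_eq_lintegral_toSphere [Nontrivial E] {g : E → ℝ≥0∞} (hg : Measurable g) :
    ∫⁻ X, g X ∂μ = ∫⁻ x, (∫⁻ r in Ioi (0 : ℝ),
      ENNReal.ofReal (r ^ (finrank ℝ E - 1)) * g (r • (x : E))) ∂μ.toSphere := by
  have hgm : Measurable fun z : sphere (0 : E) 1 × Ioi (0 : ℝ) ↦ g ((z.2 : ℝ) • (z.1 : E)) :=
    hg.comp (by fun_prop)
  calc ∫⁻ X, g X ∂μ = ∫⁻ X : ({0}ᶜ : Set E), g X ∂(μ.comap (↑)) := by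
        rw [lintegral_subtype_comap (measurableSet_singleton _).compl, restrict_compl_singleton]
    _ = ∫⁻ z : sphere (0 : E) 1 × Ioi (0 : ℝ), g ((z.2 : ℝ) • (z.1 : E))
          ∂(μ.toSphere.prod (.volumeIoiPow (finrank ℝ E - 1))) := by
        rw [← μ.measurePreserving_homeomorphUnitSphereProd.lintegral_comp_emb
          (Homeomorph.measurableEmbedding _)]
        refine lintegral_congr fun X ↦ ?_
        have hX : ‖(X : E)‖ ≠ 0 := by simpa [-Subtype.coe_prop] using X.2
        simp [smul_smul, hX]
    _ = _ := by
        rw [lintegral_prod _ hgm.aemeasurable]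
        refine lintegral_congr fun x ↦ ?_
        refine (lintegral_withDensity_eq_lintegral_mul _ (by fun_prop)
          (hgm.comp measurable_prodMk_left)).trans ?_
        exact lintegral_subtype_comap measurableSet_Ioi
          fun r : ℝ ↦ ENNReal.ofReal (r ^ (finrank ℝ E - 1)) * g (r • (x : E))

lemma lintegral_eq_mul_lintegral_comp_smul {R : ℝ} (hR : 0 < R) (g : E → ℝ≥0∞) :
    ∫⁻ x, g x ∂μ = ENNReal.ofReal (R ^ finrank ℝ E) * ∫⁻ x, g (R • x) ∂μ := by
  have h := (Homeomorph.smulOfNeZero R hR.ne' : E ≃ₜ E).measurableEmbedding.lintegral_map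
    (μ := μ) g
  have hmap : Measure.map (Homeomorph.smulOfNeZero R hR.ne' : E ≃ₜ E) μ =
    ENNReal.ofReal (abs (R ^ finrank ℝ E)⁻¹) • μ := Measure.map_addHaar_smul μ hR.ne'
  rw [hmap, lintegral_smul_measure, smul_eq_mul] at h
  have h' : ∫⁻ x, g (R • x) ∂μ = ENNReal.ofReal (abs (R ^ finrank ℝ E)⁻¹) * ∫⁻ x, g x ∂μ := h.symm
  rw [h', ← mul_assoc, ← ENNReal.ofReal_mul (by positivity), abs_of_pos (by positivity),
    mul_inv_cancel₀ (by positivity), ENNReal.ofReal_one, one_mul]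

lemma lintegral_add_norm_rpow {A : ℝ} (hA : 0 < A) (q : ℝ) :
    ∫⁻ x, ENNReal.ofReal ((A + ‖x‖) ^ (-q)) ∂μ =
      ENNReal.ofReal (A ^ (finrank ℝ E - q)) * ∫⁻ x, ENNReal.ofReal ((1 + ‖x‖) ^ (-q)) ∂μ := by
  rw [lintegral_eq_mul_lintegral_comp_smul μ hA, sub_eq_add_neg, Real.rpow_add hA,
    Real.rpow_natCast, ENNReal.ofReal_mul (by positivity), mul_assoc]
  congr 1
  rw [← lintegral_const_mul' _ _ ENNReal.ofReal_ne_top]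
  refine lintegral_congr fun x ↦ ?_
  rw [← ENNReal.ofReal_mul (by positivity), ← Real.mul_rpow hA.le (by positivity), norm_smul,
    Real.norm_of_nonneg hA.le]
  ring_nf

lemma lintegral_truncated_norm_rpow {R : ℝ} (hR : 0 < R) (b : ℝ) :
    ∫⁻ x, ENNReal.ofReal (if ‖x‖ < R then ‖x‖ ^ b else 0) ∂μ =
      ENNReal.ofReal (R ^ (finrank ℝ E + b)) *
        ∫⁻ x, ENNReal.ofReal (if ‖x‖ < 1 then ‖x‖ ^ b else 0) ∂μ := by
  rw [lintegral_eq_mul_lintegral_comp_smul μ hR, Real.rpow_add hR,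
    Real.rpow_natCast, ENNReal.ofReal_mul (by positivity), mul_assoc]
  congr 1
  rw [← lintegral_const_mul' _ _ ENNReal.ofReal_ne_top]
  refine lintegral_congr fun x ↦ ?_
  rw [← ENNReal.ofReal_mul (by positivity), norm_smul, Real.norm_of_nonneg hR.le,
    Real.mul_rpow hR.le (norm_nonneg x), mul_ite, mul_zero]
  simp only [mul_lt_iff_lt_one_right hR]

lemma lintegral_Ioo_rpow {c : ℝ} (hc : -1 < c) :
    ∫⁻ r in Ioo (0 : ℝ) 1, ENNReal.ofReal (r ^ c) = ENNReal.ofReal (1 / (c + 1)) := by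
  have hintG : IntegrableOn (fun r : ℝ ↦ r ^ c) (Ioc 0 1) :=
    (intervalIntegral.intervalIntegrable_rpow' hc (a := 0) (b := 1)).1
  rw [Measure.restrict_congr_set Ioo_ae_eq_Ioc, ← ofReal_integral_eq_lintegral_ofReal hintG,
    ← intervalIntegral.integral_of_le zero_le_one, integral_rpow (Or.inl hc)]
  · simp [Real.zero_rpow (by linarith : c + 1 ≠ 0)]
  · filter_upwards [ae_restrict_mem measurableSet_Ioc] with r hr
    exact Real.rpow_nonneg hr.1.le _

lemma lintegral_ball_rpow_mul [Nontrivial E] {b : ℝ} (hb : 0 < b + finrank ℝ E) {g : E → ℝ≥0∞}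
    (hg : Measurable g) :
    ∫⁻ X in ball 0 1, ENNReal.ofReal (‖X‖ ^ b) * g (‖X‖⁻¹ • X) ∂μ =
      ENNReal.ofReal (1 / (b + finrank ℝ E)) * ∫⁻ x, g x ∂μ.toSphere := by
  have hd : 1 ≤ finrank ℝ E := Module.finrank_pos
  rw [← lintegral_indicator measurableSet_ball, lintegral_eq_lintegral_toSphere μ
    (Measurable.indicator (by fun_prop) measurableSet_ball),
    ← lintegral_const_mul' _ _ ENNReal.ofReal_ne_top]
  refine lintegral_congr fun x ↦ ?_
  have hx : ‖(x : E)‖ = 1 := by simp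
  calc _ = ∫⁻ r in Ioi (0 : ℝ), (Iio 1).indicator
        (fun r ↦ ENNReal.ofReal (r ^ (b + finrank ℝ E - 1)) * g x) r := by
        refine setLIntegral_congr_fun measurableSet_Ioi fun r hr ↦ ?_
        have hr0 : 0 < r := hr
        have hn : ‖r • (x : E)‖ = r := by rw [norm_smul, hx, mul_one, Real.norm_of_nonneg hr0.le]
        by_cases h1 : r < 1
        · rw [indicator_of_mem (by simpa [hn] using h1), indicator_of_mem (by simpa using h1), hn,
            smul_smul, inv_mul_cancel₀ hr0.ne', one_smul, ← mul_assoc,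
            ← ENNReal.ofReal_mul (by positivity), ← Real.rpow_natCast, ← Real.rpow_add hr0,
            Nat.cast_sub hd]
          congr 3
          push_cast
          ring
        · rw [indicator_of_notMem (by simpa [hn] using h1),
            indicator_of_notMem (by simpa using h1), mul_zero]
    _ = _ := by
        rw [lintegral_indicator measurableSet_Iio, Measure.restrict_restrict measurableSet_Iio,
          Iio_inter_Ioi, lintegral_mul_const _ (by fun_prop), lintegral_Ioo_rpow (by linarith),
          sub_add_cancel]

lemma lintegral_truncated_norm_rpow_lt_top [Nontrivial E] {b : ℝ} (hb : 0 < b + finrank ℝ E) :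
    ∫⁻ x, ENNReal.ofReal (if ‖x‖ < 1 then ‖x‖ ^ b else 0) ∂μ < ∞ := by
  have h := lintegral_ball_rpow_mul μ hb (g := fun _ ↦ 1) measurable_const
  rw [← lintegral_indicator measurableSet_ball] at h
  calc _ = ENNReal.ofReal (1 / (b + finrank ℝ E)) * ∫⁻ _, 1 ∂μ.toSphere := by
        rw [← h]
        refine lintegral_congr fun x ↦ ?_
        by_cases hx : ‖x‖ < 1 <;> simp [hx]
    _ < ∞ := ENNReal.mul_lt_top ENNReal.ofReal_lt_top
        (by rw [lintegral_one]; exact measure_lt_top _ _)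

end Haar

lemma lintegral_add_abs_sub_rpow {A : ℝ} (hA : 0 < A) (q r : ℝ) :
    ∫⁻ ρ : ℝ, ENNReal.ofReal ((A + |r - ρ|) ^ (-q)) =
      ENNReal.ofReal (A ^ (1 - q)) * ∫⁻ ρ : ℝ, ENNReal.ofReal ((1 + |ρ|) ^ (-q)) := by
  have h := lintegral_add_norm_rpow (volume : Measure ℝ) hA q
  simp only [finrank_self, Nat.cast_one, Real.norm_eq_abs] at h
  rw [← h]
  exact lintegral_sub_left_eq_self (fun ρ : ℝ ↦ ENNReal.ofReal ((A + |ρ|) ^ (-q))) r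

lemma abs_add_rpow_le {p : ℝ} (hp : 0 ≤ p) (x y : ℝ) :
    |x + y| ^ p ≤ 2 ^ p * (|x| ^ p + |y| ^ p) := by
  have h1 : |x + y| ≤ 2 * max |x| |y| := by
    linarith [abs_add_le x y, le_max_left |x| |y|, le_max_right |x| |y|]
  calc |x + y| ^ p ≤ (2 * max |x| |y|) ^ p := by gcongr
    _ = 2 ^ p * max |x| |y| ^ p := by rw [Real.mul_rpow (by norm_num) (by positivity)]
    _ ≤ 2 ^ p * (|x| ^ p + |y| ^ p) := by
        gcongr
        rcases max_choice |x| |y| with h | h <;> rw [h]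
        · exact le_add_of_nonneg_right (by positivity)
        · exact le_add_of_nonneg_left (by positivity)

lemma exists_abs_rpow_sub_rpow_le (a : ℝ) :
    ∃ C : ℝ, 0 ≤ C ∧ ∀ r ρ : ℝ, 0 < ρ → ρ ≤ r → r ≤ 2 * ρ →
      |r ^ a - ρ ^ a| ≤ C * (ρ ^ a * ρ⁻¹ * (r - ρ)) := by
  have hder : ∀ t ∈ Icc (1 : ℝ) 2, HasDerivWithinAt (fun t : ℝ ↦ t ^ a) (a * t ^ (a - 1))
      (Icc 1 2) t := fun t ht ↦
    (Real.hasDerivAt_rpow_const (Or.inl (by linarith [ht.1]))).hasDerivWithinAt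
  have hbd : ∀ t ∈ Icc (1 : ℝ) 2, ‖a * t ^ (a - 1)‖ ≤ |a| * (1 + 2 ^ (a - 1)) := by
    intro t ht
    have ht0 : 0 < t := by linarith [ht.1]
    rw [norm_mul, Real.norm_eq_abs, Real.norm_of_nonneg (by positivity)]
    gcongr
    have h2 : (0 : ℝ) ≤ 2 ^ (a - 1) := by positivity
    rcases le_total 0 (a - 1) with h | h
    · linarith [Real.rpow_le_rpow ht0.le ht.2 h]
    · linarith [Real.rpow_le_one_of_one_le_of_nonpos ht.1 h]
  refine ⟨|a| * (1 + 2 ^ (a - 1)), by positivity, fun r ρ hρ h1 h2 ↦ ?_⟩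
  have hmem : r / ρ ∈ Icc (1 : ℝ) 2 :=
    ⟨by rwa [le_div_iff₀ hρ, one_mul], by rwa [div_le_iff₀ hρ]⟩
  have h := (convex_Icc (1 : ℝ) 2).norm_image_sub_le_of_norm_hasDerivWithin_le hder hbd
    (left_mem_Icc.2 one_le_two) hmem
  rw [Real.one_rpow, Real.norm_eq_abs, Real.norm_of_nonneg (by linarith [hmem.1])] at h
  have hr : r ^ a = ρ ^ a * (r / ρ) ^ a := by
    rw [← Real.mul_rpow hρ.le (by linarith [hmem.1]), mul_div_cancel₀ _ hρ.ne']
  calc |r ^ a - ρ ^ a| = ρ ^ a * |(r / ρ) ^ a - 1| := by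
        rw [hr, ← mul_sub_one, abs_mul, abs_of_pos (by positivity : 0 < ρ ^ a)]
    _ ≤ ρ ^ a * (|a| * (1 + 2 ^ (a - 1)) * (r / ρ - 1)) := by gcongr
    _ = _ := by field_simp

/-- A kernel whose symmetrization dominates the Gagliardo integrand of the radial extension
`X ↦ ‖X‖ ^ a * f (‖X‖⁻¹ • X)`, see `exists_gagliardo_le_radialMajorant`. -/
noncomputable def radialMajorant {E : Type*} [NormedAddCommGroup E] [NormedSpace ℝ E]
    (a p q : ℝ) (f : E → ℝ) (X Y : E) : ℝ :=
  ‖X‖ ^ (a * p) * |f (‖X‖⁻¹ • X)| ^ p * (‖X‖ + ‖Y‖) ^ (-q)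
  + ‖X‖ ^ (a * p) * |f (‖X‖⁻¹ • X)| ^ p * ‖X‖ ^ (-p) *
      (if ‖X - Y‖ < 4 * ‖X‖ then ‖X - Y‖ ^ (p - q) else 0)
  + if ‖Y‖ ≤ ‖X‖ then ‖X‖ ^ (a * p) * |f (‖X‖⁻¹ • X) - f (‖Y‖⁻¹ • Y)| ^ p *
      (‖X‖ * ‖‖X‖⁻¹ • X - ‖Y‖⁻¹ • Y‖ + |‖X‖ - ‖Y‖|) ^ (-q) else 0

section Majorant

variable {E : Type*} [NormedAddCommGroup E] [NormedSpace ℝ E]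

lemma radialMajorant_nonneg (a p q : ℝ) (f : E → ℝ) (X Y : E) :
    0 ≤ radialMajorant a p q f X Y := by
  unfold radialMajorant
  positivity

lemma abs_radialExtension_rpow (a p : ℝ) (f : E → ℝ) (X : E) :
    |‖X‖ ^ a * f (‖X‖⁻¹ • X)| ^ p = ‖X‖ ^ (a * p) * |f (‖X‖⁻¹ • X)| ^ p := by
  rw [abs_mul, Real.mul_rpow (by positivity) (by positivity), abs_of_nonneg (by positivity),
    Real.rpow_mul (norm_nonneg X)]

lemma norm_mul_norm_sub_add_abs_le {X Y : E} (hX : X ≠ 0) (hY : Y ≠ 0) :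
    ‖X‖ * ‖‖X‖⁻¹ • X - ‖Y‖⁻¹ • Y‖ + |‖X‖ - ‖Y‖| ≤ 3 * ‖X - Y‖ := by
  have hX' : ‖X‖ ≠ 0 := norm_ne_zero_iff.2 hX
  have hY' : ‖Y‖ ≠ 0 := norm_ne_zero_iff.2 hY
  have h1 : ‖X‖ * ‖‖X‖⁻¹ • X - ‖Y‖⁻¹ • Y‖ = ‖(X - Y) - (‖X‖ - ‖Y‖) • (‖Y‖⁻¹ • Y)‖ := by
    rw [← norm_norm X, ← norm_smul, norm_norm, smul_sub, sub_smul, smul_smul,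
      mul_inv_cancel₀ hX', smul_smul ‖Y‖, mul_inv_cancel₀ hY', one_smul, one_smul]
    congr 1
    abel
  have h2 : ‖(‖X‖ - ‖Y‖) • (‖Y‖⁻¹ • Y)‖ = |‖X‖ - ‖Y‖| := by
    rw [norm_smul, norm_smul, norm_inv, norm_norm, inv_mul_cancel₀ hY', mul_one, Real.norm_eq_abs]
  have h3 := norm_sub_le (X - Y) ((‖X‖ - ‖Y‖) • (‖Y‖⁻¹ • Y))
  have h4 := abs_norm_sub_norm_le X Y
  rw [h2] at h3
  rw [h1]
  linarith

lemma rpow_neg_le_mul_rpow_neg {q c A B : ℝ} (hq : 0 ≤ q) (hc : 0 < c) (hA : 0 < A)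
    (h : A ≤ c * B) : B ^ (-q) ≤ c ^ q * A ^ (-q) := by
  have hB : 0 < B := pos_of_mul_pos_right (hA.trans_le h) hc.le
  calc B ^ (-q) = c ^ q * (c * B) ^ (-q) := by
        rw [Real.mul_rpow hc.le hB.le, ← mul_assoc, ← Real.rpow_add hc, add_neg_cancel,
          Real.rpow_zero, one_mul]
    _ ≤ c ^ q * A ^ (-q) := by
        gcongr c ^ q * ?_
        exact Real.rpow_le_rpow_of_nonpos hA h (by linarith)

lemma exists_gagliardo_le_of_norm_le (a : ℝ) {p q : ℝ} (hp : 1 ≤ p) (hq : 0 < q) :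
    ∃ C : ℝ, 0 ≤ C ∧ ∀ (f : E → ℝ) (X Y : E), X ≠ 0 → Y ≠ 0 → ‖Y‖ ≤ ‖X‖ →
      |‖X‖ ^ a * f (‖X‖⁻¹ • X) - ‖Y‖ ^ a * f (‖Y‖⁻¹ • Y)| ^ p / ‖X - Y‖ ^ q ≤
        C * (radialMajorant a p q f X Y + radialMajorant a p q f Y X) := by
  obtain ⟨K, hK0, hK⟩ := exists_abs_rpow_sub_rpow_le a
  have hp0 : 0 ≤ p := by linarith
  refine ⟨2 ^ p * (3 ^ q + K ^ p), by positivity, fun f X Y hX hY hYX ↦ ?_⟩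
  rcases eq_or_ne X Y with rfl | hne
  · rw [sub_self, abs_zero, Real.zero_rpow (by linarith), zero_div]
    have := radialMajorant_nonneg a p q f X X
    positivity
  have hX0 : 0 < ‖X‖ := norm_pos_iff.2 hX
  have hY0 : 0 < ‖Y‖ := norm_pos_iff.2 hY
  have hXY : 0 < ‖X - Y‖ := norm_pos_iff.2 (sub_ne_zero.2 hne)
  rw [div_eq_mul_inv, ← Real.rpow_neg (norm_nonneg _)]
  have htri : ‖X‖ ≤ ‖X - Y‖ + ‖Y‖ := by simpa using norm_add_le (X - Y) Y
  have htri' : ‖X - Y‖ ≤ ‖X‖ + ‖Y‖ := norm_sub_le X Y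
  rcases lt_or_ge (2 * ‖Y‖) ‖X‖ with hfar | hnear
  · set wX := ‖X‖ ^ (a * p) * |f (‖X‖⁻¹ • X)| ^ p
    set wY := ‖Y‖ ^ (a * p) * |f (‖Y‖⁻¹ • Y)| ^ p
    have h1 : |‖X‖ ^ a * f (‖X‖⁻¹ • X) - ‖Y‖ ^ a * f (‖Y‖⁻¹ • Y)| ^ p ≤ 2 ^ p * (wX + wY) := by
      have := abs_add_rpow_le hp0 (‖X‖ ^ a * f (‖X‖⁻¹ • X)) (-(‖Y‖ ^ a * f (‖Y‖⁻¹ • Y)))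
      rwa [abs_neg, abs_radialExtension_rpow, abs_radialExtension_rpow, ← sub_eq_add_neg] at this
    have h2 : ‖X - Y‖ ^ (-q) ≤ 3 ^ q * (‖X‖ + ‖Y‖) ^ (-q) :=
      rpow_neg_le_mul_rpow_neg hq.le (by norm_num) (by positivity) (by linarith)
    have h3 : wX * (‖X‖ + ‖Y‖) ^ (-q) ≤ radialMajorant a p q f X Y := by
      unfold radialMajorant
      rw [add_assoc]
      exact le_add_of_nonneg_right (by positivity)
    have h4 : wY * (‖X‖ + ‖Y‖) ^ (-q) ≤ radialMajorant a p q f Y X := by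
      unfold radialMajorant
      rw [add_assoc, add_comm ‖X‖ ‖Y‖]
      exact le_add_of_nonneg_right (by positivity)
    calc _ ≤ 2 ^ p * (wX + wY) * (3 ^ q * (‖X‖ + ‖Y‖) ^ (-q)) := by gcongr
      _ = 2 ^ p * 3 ^ q * (wX * (‖X‖ + ‖Y‖) ^ (-q) + wY * (‖X‖ + ‖Y‖) ^ (-q)) := by ring
      _ ≤ 2 ^ p * (3 ^ q + K ^ p) *
          (radialMajorant a p q f X Y + radialMajorant a p q f Y X) := by
        gcongr
        exact le_add_of_nonneg_right (by positivity)
  · set Δ := f (‖X‖⁻¹ • X) - f (‖Y‖⁻¹ • Y) with hΔ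
    set A := ‖X‖ * ‖‖X‖⁻¹ • X - ‖Y‖⁻¹ • Y‖ + |‖X‖ - ‖Y‖|
    have h1 : |‖X‖ ^ a * f (‖X‖⁻¹ • X) - ‖Y‖ ^ a * f (‖Y‖⁻¹ • Y)| ^ p ≤
        2 ^ p * (|‖X‖ ^ a * Δ| ^ p + |(‖X‖ ^ a - ‖Y‖ ^ a) * f (‖Y‖⁻¹ • Y)| ^ p) := by
      refine le_of_eq_of_le ?_ (abs_add_rpow_le hp0 _ _)
      congr 2
      rw [hΔ]
      ring
    have h2 : |‖X‖ ^ a * Δ| ^ p = ‖X‖ ^ (a * p) * |Δ| ^ p := by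
      rw [abs_mul, Real.mul_rpow (by positivity) (by positivity), abs_of_nonneg (by positivity),
        Real.rpow_mul (norm_nonneg X)]
    have h3 : ‖X‖ ^ (a * p) * |Δ| ^ p * ‖X - Y‖ ^ (-q) ≤
        3 ^ q * (‖X‖ ^ (a * p) * |Δ| ^ p * A ^ (-q)) := by
      rcases (show 0 ≤ A by positivity).eq_or_lt with h0 | hpos
      · have h5 : ‖X‖ * ‖‖X‖⁻¹ • X - ‖Y‖⁻¹ • Y‖ = 0 := by
          have h6 : 0 ≤ ‖X‖ * ‖‖X‖⁻¹ • X - ‖Y‖⁻¹ • Y‖ := by positivity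
          have h7 := abs_nonneg (‖X‖ - ‖Y‖)
          linarith
        have h6 : ‖X‖⁻¹ • X = ‖Y‖⁻¹ • Y := by
          rw [← sub_eq_zero, ← norm_eq_zero]
          exact (mul_eq_zero.1 h5).resolve_left hX0.ne'
        have h7 : Δ = 0 := by rw [hΔ, h6, sub_self]
        rw [h7, abs_zero, Real.zero_rpow (by linarith)]
        simp
      · have := rpow_neg_le_mul_rpow_neg hq.le (by norm_num : (0 : ℝ) < 3) hpos
          (norm_mul_norm_sub_add_abs_le hX hY)
        calc _ ≤ ‖X‖ ^ (a * p) * |Δ| ^ p * (3 ^ q * A ^ (-q)) := by gcongr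
          _ = _ := by ring
    have h4 : |(‖X‖ ^ a - ‖Y‖ ^ a) * f (‖Y‖⁻¹ • Y)| ^ p * ‖X - Y‖ ^ (-q) ≤
        K ^ p * (‖Y‖ ^ (a * p) * |f (‖Y‖⁻¹ • Y)| ^ p * ‖Y‖ ^ (-p) * ‖X - Y‖ ^ (p - q)) := by
      have h5 : |(‖X‖ ^ a - ‖Y‖ ^ a) * f (‖Y‖⁻¹ • Y)| ≤
          K * (‖Y‖ ^ a * ‖Y‖⁻¹ * ‖X - Y‖) * |f (‖Y‖⁻¹ • Y)| := by
        rw [abs_mul]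
        gcongr
        refine (hK _ _ hY0 hYX hnear).trans ?_
        gcongr
        linarith
      calc _ ≤ (K * (‖Y‖ ^ a * ‖Y‖⁻¹ * ‖X - Y‖) * |f (‖Y‖⁻¹ • Y)|) ^ p * ‖X - Y‖ ^ (-q) := by
            gcongr
        _ = _ := by
            rw [Real.mul_rpow (by positivity) (by positivity),
              Real.mul_rpow (by positivity) (by positivity),
              Real.mul_rpow (by positivity) (by positivity),
              Real.mul_rpow (by positivity) (by positivity), Real.rpow_mul hY0.le,
              Real.inv_rpow hY0.le, ← Real.rpow_neg hY0.le, sub_eq_add_neg p q,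
              Real.rpow_add hXY]
            ring
    have h5 : ‖X‖ ^ (a * p) * |Δ| ^ p * A ^ (-q) ≤ radialMajorant a p q f X Y := by
      unfold radialMajorant
      rw [if_pos hYX]
      exact le_add_of_nonneg_left (by positivity)
    have h6 : ‖Y‖ ^ (a * p) * |f (‖Y‖⁻¹ • Y)| ^ p * ‖Y‖ ^ (-p) * ‖X - Y‖ ^ (p - q) ≤
        radialMajorant a p q f Y X := by
      unfold radialMajorant
      rw [norm_sub_rev Y X, if_pos (by linarith : ‖X - Y‖ < 4 * ‖Y‖)]
      refine le_add_of_le_of_nonneg (le_add_of_nonneg_left (by positivity)) ?_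
      positivity
    have h7 := radialMajorant_nonneg a p q f X Y
    have h8 := radialMajorant_nonneg a p q f Y X
    have h9 : (0 : ℝ) ≤ 3 ^ q := by positivity
    have h10 : 0 ≤ K ^ p := by positivity
    calc _ ≤ 2 ^ p * (|‖X‖ ^ a * Δ| ^ p + |(‖X‖ ^ a - ‖Y‖ ^ a) * f (‖Y‖⁻¹ • Y)| ^ p) *
          ‖X - Y‖ ^ (-q) := by gcongr
      _ = 2 ^ p * (‖X‖ ^ (a * p) * |Δ| ^ p * ‖X - Y‖ ^ (-q) +
          |(‖X‖ ^ a - ‖Y‖ ^ a) * f (‖Y‖⁻¹ • Y)| ^ p * ‖X - Y‖ ^ (-q)) := by rw [h2]; ring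
      _ ≤ 2 ^ p * (3 ^ q * radialMajorant a p q f X Y + K ^ p * radialMajorant a p q f Y X) := by
          gcongr 2 ^ p * (?_ + ?_)
          · exact h3.trans (by gcongr)
          · exact h4.trans (by gcongr)
      _ ≤ _ := by
          rw [mul_assoc]
          gcongr
          nlinarith [mul_nonneg h9 h8, mul_nonneg h10 h7]

lemma exists_gagliardo_le_radialMajorant (a : ℝ) {p q : ℝ} (hp : 1 ≤ p) (hq : 0 < q) :
    ∃ C : ℝ, 0 ≤ C ∧ ∀ (f : E → ℝ) (X Y : E), X ≠ 0 → Y ≠ 0 →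
      |‖X‖ ^ a * f (‖X‖⁻¹ • X) - ‖Y‖ ^ a * f (‖Y‖⁻¹ • Y)| ^ p / ‖X - Y‖ ^ q ≤
        C * (radialMajorant a p q f X Y + radialMajorant a p q f Y X) := by
  obtain ⟨C, hC0, hC⟩ := exists_gagliardo_le_of_norm_le (E := E) a hp hq
  refine ⟨C, hC0, fun f X Y hX hY ↦ ?_⟩
  rcases le_total ‖Y‖ ‖X‖ with h | h
  · exact hC f X Y hX hY h
  · rw [abs_sub_comm, norm_sub_rev, add_comm]
    exact hC f Y X hY hX h

end Majorant

lemma lintegral_lintegral_le_of_le_symm {α : Type*} [MeasurableSpace α] {ν : Measure α}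
    [SFinite ν] {F G : α → α → ℝ≥0∞} (hG : Measurable (Function.uncurry G)) {C : ℝ≥0∞}
    (hC : C ≠ ∞) (hFG : ∀ᵐ x ∂ν, ∀ᵐ y ∂ν, F x y ≤ C * (G x y + G y x)) :
    ∫⁻ x, ∫⁻ y, F x y ∂ν ∂ν ≤ C * (2 * ∫⁻ x, ∫⁻ y, G x y ∂ν ∂ν) := by
  have hswap : ∫⁻ x, ∫⁻ y, G y x ∂ν ∂ν = ∫⁻ x, ∫⁻ y, G x y ∂ν ∂ν :=
    lintegral_lintegral_swap (hG.comp measurable_swap).aemeasurable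
  rw [two_mul]
  nth_rw 2 [← hswap]
  have hintG : Measurable fun x ↦ ∫⁻ y, G x y ∂ν := hG.lintegral_prod_right'
  rw [← lintegral_add_left hintG, ← lintegral_const_mul' _ _ hC]
  refine lintegral_mono_ae ?_
  filter_upwards [hFG] with x hx
  have hGx : Measurable (G x) := hG.comp measurable_prodMk_left
  rw [← lintegral_add_left hGx, ← lintegral_const_mul' _ _ hC]
  exact lintegral_mono_ae hx

section Integral

variable {E : Type*} [NormedAddCommGroup E] [NormedSpace ℝ E] [FiniteDimensional ℝ E]
  [MeasurableSpace E] [BorelSpace E]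

lemma measurable_radialMajorant (a p q : ℝ) {f : E → ℝ} (hf : Measurable f) :
    Measurable fun z : E × E ↦ radialMajorant a p q f z.1 z.2 := by
  unfold radialMajorant
  refine Measurable.add (by fun_prop) ?_ |>.add ?_
  · refine Measurable.mul (by fun_prop) (Measurable.ite ?_ (by fun_prop) measurable_const)
    exact measurableSet_lt (by fun_prop) (by fun_prop)
  · refine Measurable.ite ?_ (by fun_prop) measurable_const
    exact measurableSet_le (by fun_prop) (by fun_prop)

variable (μ : Measure E) [μ.IsAddHaarMeasure]

lemma measurable_lintegral_toSphere_sub_rpow (p c : ℝ) {f : E → ℝ} (hf : Measurable f) :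
    Measurable fun x : E ↦
      ∫⁻ y, ENNReal.ofReal (|f x - f y| ^ p * ‖x - y‖ ^ c) ∂μ.toSphere :=
  Measurable.lintegral_prod_right'
    (f := fun z : E × sphere (0 : E) 1 ↦
      ENNReal.ofReal (|f z.1 - f z.2| ^ p * ‖z.1 - z.2‖ ^ c)) (by fun_prop)

lemma exists_lintegral_angular_le [Nontrivial E] (a : ℝ) {p q : ℝ} (hp : 1 ≤ p) (hq : 1 < q) :
    ∃ C : ℝ≥0∞, C ≠ ∞ ∧ ∀ f : E → ℝ, Measurable f → ∀ X : E, X ≠ 0 →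
      ∫⁻ Y, ENNReal.ofReal (if ‖Y‖ ≤ ‖X‖ then ‖X‖ ^ (a * p) *
          |f (‖X‖⁻¹ • X) - f (‖Y‖⁻¹ • Y)| ^ p *
          (‖X‖ * ‖‖X‖⁻¹ • X - ‖Y‖⁻¹ • Y‖ + |‖X‖ - ‖Y‖|) ^ (-q) else 0) ∂μ ≤
        ENNReal.ofReal (‖X‖ ^ (a * p + finrank ℝ E - q)) *
          (C * ∫⁻ y, ENNReal.ofReal (|f (‖X‖⁻¹ • X) - f y| ^ p *
            ‖‖X‖⁻¹ • X - y‖ ^ (1 - q)) ∂μ.toSphere) := by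
  have hd : 1 ≤ finrank ℝ E := Module.finrank_pos
  set J := ∫⁻ ρ : ℝ, ENNReal.ofReal ((1 + |ρ|) ^ (-q))
  have hJtop : J ≠ ∞ :=
    (finite_integral_one_add_norm (μ := (volume : Measure ℝ)) (by simpa using hq)).ne
  refine ⟨J, hJtop, fun f hf X hX ↦ ?_⟩
  have hr : 0 < ‖X‖ := norm_pos_iff.2 hX
  set r := ‖X‖
  set x := r⁻¹ • X
  have hmeas : Measurable fun Y : E ↦ ENNReal.ofReal (if ‖Y‖ ≤ r then r ^ (a * p) *
      |f x - f (‖Y‖⁻¹ • Y)| ^ p * (r * ‖x - ‖Y‖⁻¹ • Y‖ + |r - ‖Y‖|) ^ (-q) else 0) := by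
    refine (Measurable.ite ?_ (by fun_prop) measurable_const).ennreal_ofReal
    exact measurableSet_le (by fun_prop) (by fun_prop)
  rw [lintegral_eq_lintegral_toSphere μ hmeas, ← lintegral_const_mul' _ _ hJtop,
    ← lintegral_const_mul' _ _ ENNReal.ofReal_ne_top]
  refine lintegral_mono fun y ↦ ?_
  have hy : ‖(y : E)‖ = 1 := by simp
  have hρy : ∀ ρ : ℝ, 0 < ρ → ‖ρ • (y : E)‖ = ρ := fun ρ hρ ↦ by
    rw [norm_smul, hy, mul_one, Real.norm_of_nonneg hρ.le]
  rcases eq_or_ne x (y : E) with hxy | hxy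
  · refine le_of_eq_of_le ?_ zero_le
    rw [setLIntegral_congr_fun (g := fun _ ↦ 0) measurableSet_Ioi]
    · simp
    · intro ρ hρ
      have hρ0 : 0 < ρ := hρ
      simp only [hρy ρ hρ0, smul_smul, inv_mul_cancel₀ hρ0.ne', one_smul, hxy, sub_self, abs_zero,
        Real.zero_rpow (by linarith : p ≠ 0), mul_zero, zero_mul, ite_self, ENNReal.ofReal_zero]
  have hδ : 0 < ‖x - y‖ := norm_pos_iff.2 (sub_ne_zero.2 hxy)
  calc _ ≤ ∫⁻ ρ in Ioi (0 : ℝ), ENNReal.ofReal (r ^ (finrank ℝ E - 1) *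
          (r ^ (a * p) * |f x - f y| ^ p)) *
          ENNReal.ofReal ((r * ‖x - y‖ + |r - ρ|) ^ (-q)) := by
        refine setLIntegral_mono' measurableSet_Ioi fun ρ hρ ↦ ?_
        have hρ0 : 0 < ρ := hρ
        simp only [hρy ρ hρ0, smul_smul, inv_mul_cancel₀ hρ0.ne', one_smul]
        rw [← ENNReal.ofReal_mul (by positivity), ← ENNReal.ofReal_mul (by positivity)]
        refine ENNReal.ofReal_le_ofReal ?_
        split_ifs with h
        · rw [mul_assoc (r ^ (finrank ℝ E - 1))]
          gcongr
        · rw [mul_zero]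
          positivity
    _ ≤ ENNReal.ofReal (r ^ (finrank ℝ E - 1) * (r ^ (a * p) * |f x - f y| ^ p)) *
          (ENNReal.ofReal ((r * ‖x - y‖) ^ (1 - q)) * J) := by
        rw [lintegral_const_mul' _ _ ENNReal.ofReal_ne_top,
          ← lintegral_add_abs_sub_rpow (by positivity) q r]
        gcongr
        exact Measure.restrict_le_self
    _ = _ := by
        rw [← mul_assoc, ← ENNReal.ofReal_mul (by positivity), mul_left_comm, mul_comm J,
          ← mul_assoc, ← mul_assoc, ← ENNReal.ofReal_mul (by positivity)]
        congr 2
        rw [Real.mul_rpow hr.le hδ.le, ← Real.rpow_natCast, Nat.cast_sub hd,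
          show a * p + finrank ℝ E - q = ((finrank ℝ E : ℝ) - 1) + a * p + (1 - q) by ring,
          Real.rpow_add hr, Real.rpow_add hr]
        push_cast
        ring

lemma exists_lintegral_radialMajorant_le [Nontrivial E] (a : ℝ) {s p : ℝ} (hs0 : 0 < s)
    (hs1 : s < 1) (hp : 1 ≤ p) :
    ∃ C : ℝ≥0∞, C ≠ ∞ ∧ ∀ f : E → ℝ, Measurable f → ∀ X : E, X ≠ 0 →
      ∫⁻ Y, ENNReal.ofReal (radialMajorant a p (finrank ℝ E + s * p) f X Y) ∂μ ≤
        ENNReal.ofReal (‖X‖ ^ ((a - s) * p)) *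
          (C * (ENNReal.ofReal (|f (‖X‖⁻¹ • X)| ^ p) +
            ∫⁻ y, ENNReal.ofReal (|f (‖X‖⁻¹ • X) - f y| ^ p *
              ‖‖X‖⁻¹ • X - y‖ ^ (1 - (finrank ℝ E + s * p))) ∂μ.toSphere)) := by
  have hd : (1 : ℝ) ≤ finrank ℝ E := by exact_mod_cast (Module.finrank_pos (R := ℝ) (M := E))
  have hsp : 0 < s * p := by positivity
  have hsp' : s * p < p := by nlinarith
  set q : ℝ := finrank ℝ E + s * p with hq
  obtain ⟨C, hC, hang⟩ := exists_lintegral_angular_le μ a hp (by linarith : 1 < q)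
  set J₁ := ∫⁻ Y, ENNReal.ofReal ((1 + ‖Y‖) ^ (-q)) ∂μ
  have hJ₁top : J₁ ≠ ∞ := (finite_integral_one_add_norm (by linarith)).ne
  set J₂ := ∫⁻ Y, ENNReal.ofReal (if ‖Y‖ < 1 then ‖Y‖ ^ (p - q) else 0) ∂μ
  have hJ₂top : J₂ ≠ ∞ := (lintegral_truncated_norm_rpow_lt_top μ (by linarith)).ne
  refine ⟨J₁ + ENNReal.ofReal (4 ^ (p - s * p)) * J₂ + C, by finiteness, fun f hf X hX ↦ ?_⟩
  have hr : 0 < ‖X‖ := norm_pos_iff.2 hX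
  have hmeas : Measurable fun Y : E ↦ ‖X‖ ^ (a * p) * |f (‖X‖⁻¹ • X)| ^ p *
      (‖X‖ + ‖Y‖) ^ (-q) := by fun_prop
  have hmeas' : Measurable fun Y : E ↦ ‖X‖ ^ (a * p) * |f (‖X‖⁻¹ • X)| ^ p * ‖X‖ ^ (-p) *
      (if ‖X - Y‖ < 4 * ‖X‖ then ‖X - Y‖ ^ (p - q) else 0) := by
    refine measurable_const.mul (Measurable.ite ?_ (by fun_prop) measurable_const)
    exact measurableSet_lt (by fun_prop) (by fun_prop)
  have hsum : Measurable fun Y : E ↦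
      ENNReal.ofReal (‖X‖ ^ (a * p) * |f (‖X‖⁻¹ • X)| ^ p * (‖X‖ + ‖Y‖) ^ (-q)) +
        ENNReal.ofReal (‖X‖ ^ (a * p) * |f (‖X‖⁻¹ • X)| ^ p * ‖X‖ ^ (-p) *
          (if ‖X - Y‖ < 4 * ‖X‖ then ‖X - Y‖ ^ (p - q) else 0)) :=
    hmeas.ennreal_ofReal.add hmeas'.ennreal_ofReal
  have h1 : ∫⁻ Y, ENNReal.ofReal (‖X‖ ^ (a * p) * |f (‖X‖⁻¹ • X)| ^ p *
      (‖X‖ + ‖Y‖) ^ (-q)) ∂μ =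
      ENNReal.ofReal (‖X‖ ^ ((a - s) * p)) * (J₁ * ENNReal.ofReal (|f (‖X‖⁻¹ • X)| ^ p)) := by
    simp_rw [ENNReal.ofReal_mul (by positivity :
      0 ≤ ‖X‖ ^ (a * p) * |f (‖X‖⁻¹ • X)| ^ p)]
    rw [lintegral_const_mul' _ _ (by finiteness), lintegral_add_norm_rpow μ hr q, ← mul_assoc,
      ← ENNReal.ofReal_mul (by positivity), mul_comm J₁, ← mul_assoc,
      ← ENNReal.ofReal_mul (by positivity)]
    congr 2
    rw [show (a - s) * p = a * p + (finrank ℝ E - q) by rw [hq]; ring, Real.rpow_add hr]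
    ring
  have h2 : ∫⁻ Y, ENNReal.ofReal (‖X‖ ^ (a * p) * |f (‖X‖⁻¹ • X)| ^ p * ‖X‖ ^ (-p) *
      (if ‖X - Y‖ < 4 * ‖X‖ then ‖X - Y‖ ^ (p - q) else 0)) ∂μ =
      ENNReal.ofReal (‖X‖ ^ ((a - s) * p)) *
        (ENNReal.ofReal (4 ^ (p - s * p)) * J₂ * ENNReal.ofReal (|f (‖X‖⁻¹ • X)| ^ p)) := by
    simp_rw [ENNReal.ofReal_mul (by positivity :
      0 ≤ ‖X‖ ^ (a * p) * |f (‖X‖⁻¹ • X)| ^ p * ‖X‖ ^ (-p))]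
    rw [lintegral_const_mul' _ _ (by finiteness),
      lintegral_sub_left_eq_self
        (fun Y ↦ ENNReal.ofReal (if ‖Y‖ < 4 * ‖X‖ then ‖Y‖ ^ (p - q) else 0)) X,
      lintegral_truncated_norm_rpow μ (by positivity) (p - q), ← mul_assoc,
      ← ENNReal.ofReal_mul (by positivity), mul_right_comm (ENNReal.ofReal (4 ^ (p - s * p))),
      ← mul_assoc, ← ENNReal.ofReal_mul (by positivity), ← ENNReal.ofReal_mul (by positivity)]
    congr 2
    rw [show (a - s) * p = a * p + -p + (p - s * p) by ring, Real.rpow_add hr, Real.rpow_add hr,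
      show finrank ℝ E + (p - q) = p - s * p by rw [hq]; ring,
      Real.mul_rpow (by norm_num) hr.le]
    ring
  have h3 := hang f hf X hX
  rw [show a * p + finrank ℝ E - q = (a - s) * p by rw [hq]; ring] at h3
  calc _ = ∫⁻ Y, ENNReal.ofReal (‖X‖ ^ (a * p) * |f (‖X‖⁻¹ • X)| ^ p *
          (‖X‖ + ‖Y‖) ^ (-q)) ∂μ +
        ∫⁻ Y, ENNReal.ofReal (‖X‖ ^ (a * p) * |f (‖X‖⁻¹ • X)| ^ p * ‖X‖ ^ (-p) *
          (if ‖X - Y‖ < 4 * ‖X‖ then ‖X - Y‖ ^ (p - q) else 0)) ∂μ +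
        ∫⁻ Y, ENNReal.ofReal (if ‖Y‖ ≤ ‖X‖ then ‖X‖ ^ (a * p) *
          |f (‖X‖⁻¹ • X) - f (‖Y‖⁻¹ • Y)| ^ p *
          (‖X‖ * ‖‖X‖⁻¹ • X - ‖Y‖⁻¹ • Y‖ + |‖X‖ - ‖Y‖|) ^ (-q) else 0) ∂μ := by
        rw [← lintegral_add_left hmeas.ennreal_ofReal,
          ← lintegral_add_left hsum]
        refine lintegral_congr fun Y ↦ ?_
        rw [radialMajorant, ENNReal.ofReal_add (by positivity) (by positivity),
          ENNReal.ofReal_add (by positivity) (by positivity)]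
    _ ≤ _ := by
        rw [h1, h2]
        grw [h3]
        rw [← mul_add, ← mul_add]
        gcongr
        rw [mul_add, ← add_mul]
        refine add_le_add ?_ ?_
        · gcongr ?_ * _
          exact le_self_add
        · gcongr
          exact le_add_self

theorem exists_lintegral_gagliardo_radialExtension_le (hdim : 2 ≤ finrank ℝ E) (a : ℝ) {s p : ℝ}
    (hs0 : 0 < s) (hs1 : s < 1) (hp : 1 ≤ p) (hsp : (s - a) * p < finrank ℝ E) :
    ∃ C : ℝ≥0∞, C ≠ ∞ ∧ ∀ f : E → ℝ, Measurable f →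
      (∫⁻ X in ball 0 1, ENNReal.ofReal (|‖X‖ ^ a * f (‖X‖⁻¹ • X)| ^ p) ∂μ)
      + (∫⁻ X in ball 0 1, ∫⁻ Y in ball 0 1,
          ENNReal.ofReal (|‖X‖ ^ a * f (‖X‖⁻¹ • X) - ‖Y‖ ^ a * f (‖Y‖⁻¹ • Y)| ^ p /
            ‖X - Y‖ ^ (finrank ℝ E + s * p)) ∂μ ∂μ)
      ≤ C * (∫⁻ x, ENNReal.ofReal (|f x| ^ p) ∂μ.toSphere
        + ∫⁻ x, ∫⁻ y, ENNReal.ofReal (|f x - f y| ^ p *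
            ‖(x : E) - y‖ ^ (1 - (finrank ℝ E + s * p))) ∂μ.toSphere ∂μ.toSphere) := by
  have : Nontrivial E := Module.nontrivial_of_finrank_pos (R := ℝ) (by lia)
  have hspos : 0 < s * p := by positivity
  set q : ℝ := finrank ℝ E + s * p with hq
  have hb : 0 < (a - s) * p + finrank ℝ E := by linarith [sub_mul s a p, sub_mul a s p]
  obtain ⟨C₀, hC₀, hpt⟩ := exists_gagliardo_le_radialMajorant (E := E) a hp
    (by positivity : 0 < q)
  obtain ⟨D, hD, hintG⟩ := exists_lintegral_radialMajorant_le μ a hs0 hs1 hp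
  set κ := ENNReal.ofReal (1 / ((a - s) * p + finrank ℝ E))
  refine ⟨κ + ENNReal.ofReal C₀ * (2 * (κ * D)), by finiteness, fun f hf ↦ ?_⟩
  set g : E → ℝ≥0∞ := fun x ↦
    ∫⁻ y, ENNReal.ofReal (|f x - f y| ^ p * ‖x - y‖ ^ (1 - q)) ∂μ.toSphere
  have hgm : Measurable g := measurable_lintegral_toSphere_sub_rpow μ p (1 - q) hf
  have hne : ∀ᵐ X ∂(μ.restrict (ball 0 1)), X ≠ 0 :=
    ae_restrict_of_ae (Measure.ae_ne μ 0)
  have hmaj : Measurable (Function.uncurry fun X Y ↦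
      ENNReal.ofReal (radialMajorant a p q f X Y)) :=
    (measurable_radialMajorant a p q hf).ennreal_ofReal
  have h1 : ∫⁻ X in ball 0 1, ENNReal.ofReal (|‖X‖ ^ a * f (‖X‖⁻¹ • X)| ^ p) ∂μ ≤
      κ * ∫⁻ x, ENNReal.ofReal (|f x| ^ p) ∂μ.toSphere := by
    rw [← lintegral_ball_rpow_mul μ hb (g := fun x ↦ ENNReal.ofReal (|f x| ^ p)) (by fun_prop)]
    refine lintegral_mono_ae ?_
    filter_upwards [hne, ae_restrict_mem measurableSet_ball] with X hX0 hX1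
    have hr : 0 < ‖X‖ := norm_pos_iff.2 hX0
    rw [abs_radialExtension_rpow, ← ENNReal.ofReal_mul (by positivity)]
    refine ENNReal.ofReal_le_ofReal ?_
    gcongr ?_ * _
    exact Real.rpow_le_rpow_of_exponent_ge hr (mem_ball_zero_iff.1 hX1).le
      (by linarith [sub_mul a s p])
  have h2 : ∫⁻ X in ball 0 1, ∫⁻ Y in ball 0 1,
      ENNReal.ofReal (radialMajorant a p q f X Y) ∂μ ∂μ ≤
      κ * D * (∫⁻ x, ENNReal.ofReal (|f x| ^ p) ∂μ.toSphere + ∫⁻ x, g x ∂μ.toSphere) := by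
    rw [← lintegral_add_left (by fun_prop), mul_assoc, ← lintegral_const_mul' _ _ hD,
      ← lintegral_ball_rpow_mul μ hb (g := fun x ↦ D * (ENNReal.ofReal (|f x| ^ p) + g x))
        (by fun_prop)]
    refine lintegral_mono_ae ?_
    filter_upwards [hne] with X hX
    exact (setLIntegral_le_lintegral _ _).trans (hintG f hf X hX)
  have h3 : ∫⁻ X in ball 0 1, ∫⁻ Y in ball 0 1,
      ENNReal.ofReal (|‖X‖ ^ a * f (‖X‖⁻¹ • X) - ‖Y‖ ^ a * f (‖Y‖⁻¹ • Y)| ^ p /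
        ‖X - Y‖ ^ q) ∂μ ∂μ ≤
      ENNReal.ofReal C₀ * (2 * ∫⁻ X in ball 0 1, ∫⁻ Y in ball 0 1,
        ENNReal.ofReal (radialMajorant a p q f X Y) ∂μ ∂μ) := by
    refine lintegral_lintegral_le_of_le_symm hmaj ENNReal.ofReal_ne_top ?_
    filter_upwards [hne] with X hX
    filter_upwards [hne] with Y hY
    rw [← ENNReal.ofReal_add (radialMajorant_nonneg ..) (radialMajorant_nonneg ..),
      ← ENNReal.ofReal_mul hC₀]
    exact ENNReal.ofReal_le_ofReal (hpt f X Y hX hY)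
  grw [h1, h3, h2, add_mul, mul_assoc, mul_assoc, mul_assoc, mul_assoc]
  gcongr
  exact le_self_add

end Integral

/-- boundedness of the radial extension `U_a f (X) = |X|^a f(X/|X|)`
from `W^{s,p}(∂B)` into `W^{s,p}(B)`, with explicit integral (semi-)norms. -/
theorem radial_extension_bounded_fractional
    (n : ℕ) (hn : 2 ≤ n) (a s p : ℝ) (hs0 : 0 < s) (hs1 : s < 1)
    (hp : 1 ≤ p) (hspn : (s - a) * p < n) :
    ∃ C : ℝ, 0 < C ∧
      ∀ f : EuclideanSpace ℝ (Fin n) → ℝ, Measurable f →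
        (∫⁻ X in ball (0 : EuclideanSpace ℝ (Fin n)) 1,
            ENNReal.ofReal (|‖X‖ ^ a * f (‖X‖⁻¹ • X)| ^ p))
        + (∫⁻ X in ball (0 : EuclideanSpace ℝ (Fin n)) 1,
            ∫⁻ Y in ball (0 : EuclideanSpace ℝ (Fin n)) 1,
              ENNReal.ofReal
                (|‖X‖ ^ a * f (‖X‖⁻¹ • X) - ‖Y‖ ^ a * f (‖Y‖⁻¹ • Y)| ^ p
                  / ‖X - Y‖ ^ ((n : ℝ) + s * p)))
        ≤ ENNReal.ofReal C *
          ((∫⁻ x in sphere (0 : EuclideanSpace ℝ (Fin n)) 1,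
              ENNReal.ofReal (|f x| ^ p) ∂μH[(n : ℝ) - 1])
           + ∫⁻ x in sphere (0 : EuclideanSpace ℝ (Fin n)) 1,
               ∫⁻ y in sphere (0 : EuclideanSpace ℝ (Fin n)) 1,
                 ENNReal.ofReal
                   (|f x - f y| ^ p / ‖x - y‖ ^ ((n : ℝ) - 1 + s * p))
               ∂μH[(n : ℝ) - 1] ∂μH[(n : ℝ) - 1]) := by
  have hfr : finrank ℝ (EuclideanSpace ℝ (Fin n)) = n := by simp
  obtain ⟨C, hC, hle⟩ := exists_lintegral_gagliardo_radialExtension_le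
    (volume : Measure (EuclideanSpace ℝ (Fin n))) (by rwa [hfr]) a hs0 hs1 hp (by rwa [hfr])
  obtain ⟨M, hM⟩ := lintegral_toSphere_le_hausdorffMeasure
    (volume : Measure (EuclideanSpace ℝ (Fin n))) (by rwa [hfr])
  rw [hfr] at hle hM
  have hfin : C * (M + M * M) ≠ ∞ := by finiteness
  refine ⟨(C * (M + M * M)).toReal + 1, by positivity, fun f hf ↦ ?_⟩
  have hCC : C * (M + M * M) ≤ ENNReal.ofReal ((C * (M + M * M)).toReal + 1) := by
    rw [ENNReal.le_ofReal_iff_toReal_le hfin (by positivity)]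
    linarith
  refine (hle f hf).trans ?_
  grw [← hCC, mul_assoc]
  have h1 := hM fun x ↦ ENNReal.ofReal (|f x| ^ p)
  have hker : ∀ x y : EuclideanSpace ℝ (Fin n),
      |f x - f y| ^ p * ‖x - y‖ ^ (1 - (n + s * p)) =
        |f x - f y| ^ p / ‖x - y‖ ^ ((n : ℝ) - 1 + s * p) := fun x y ↦ by
    rw [div_eq_mul_inv, ← Real.rpow_neg (norm_nonneg _)]
    ring_nf
  simp_rw [hker]
  have h2 : ∫⁻ x, ∫⁻ y, ENNReal.ofReal (|f x - f y| ^ p /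
      ‖(x : EuclideanSpace ℝ (Fin n)) - y‖ ^ ((n : ℝ) - 1 + s * p))
      ∂(volume : Measure (EuclideanSpace ℝ (Fin n))).toSphere
      ∂(volume : Measure (EuclideanSpace ℝ (Fin n))).toSphere ≤
      M * (M * ∫⁻ x in sphere (0 : EuclideanSpace ℝ (Fin n)) 1,
        ∫⁻ y in sphere (0 : EuclideanSpace ℝ (Fin n)) 1,
          ENNReal.ofReal (|f x - f y| ^ p / ‖x - y‖ ^ ((n : ℝ) - 1 + s * p))
            ∂μH[(n : ℝ) - 1] ∂μH[(n : ℝ) - 1]) := by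
    rw [← lintegral_const_mul' _ _ ENNReal.coe_ne_top]
    refine le_trans ?_ (hM _)
    exact lintegral_mono fun x ↦ hM fun y ↦ ENNReal.ofReal (|f x - f y| ^ p /
      ‖(x : EuclideanSpace ℝ (Fin n)) - y‖ ^ ((n : ℝ) - 1 + s * p))
  grw [h1, h2]
  gcongr
  rw [mul_add, ← mul_assoc]
  gcongr
  · exact le_self_add
  · exact le_add_self
end

section
/- Let $a \in \mathbb{R}$, $0 < s < 1$, $1 \le p < \infty$ and $n \ge 2$ be such that $n + ap > 0$. Then there exists a constant $C > 0$, depending only on $a, s, p, n$, such that for every measurable function $f : \partial B \to \mathbb{R}$ one has $\int_{\partial B}\int_{\partial B}\int_0^{1/2} t^{n-1}\,\frac{|f(x) - t^a f(y)|^p}{|x - t\,y|^{n+sp}}\, dt\, d\sigma(x)\, d\sigma(y) \le C \int_{\partial B} |f|^p \, d\sigma$, where both sides are interpreted as values in $[0,\infty]$. -/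
open MeasureTheory Metric

/-- Radial projection to the unit sphere of the graph at height `c` over the `i`-th coordinate
hyperplane. -/
noncomputable def sphereChart {m : ℕ} (i : Fin (m + 1)) (c : ℝ) (v : Fin m → ℝ) :
    EuclideanSpace ℝ (Fin (m + 1)) :=
  ‖WithLp.toLp 2 (i.insertNth c v : Fin (m + 1) → ℝ)‖⁻¹ •
    WithLp.toLp 2 (i.insertNth c v : Fin (m + 1) → ℝ)

lemma contDiff_sphereChart {m : ℕ} (i : Fin (m + 1)) {c : ℝ} (hc : c ≠ 0) :
    ContDiff ℝ 1 (sphereChart i c) := by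
  have h : ContDiff ℝ 1 fun v : Fin m → ℝ =>
      (WithLp.toLp 2 (i.insertNth c v : Fin (m + 1) → ℝ) : EuclideanSpace ℝ (Fin (m + 1))) := by
    rw [contDiff_euclidean]
    intro j
    refine i.succAboveCases ?_ (fun k => ?_) j
    · simpa using contDiff_const
    · simpa using contDiff_apply ℝ ℝ k
  have hne : ∀ v : Fin m → ℝ,
      (WithLp.toLp 2 (i.insertNth c v : Fin (m + 1) → ℝ) : EuclideanSpace ℝ (Fin (m + 1))) ≠ 0 := by
    intro v hv
    have := congrArg (fun z : EuclideanSpace ℝ (Fin (m + 1)) => z i) hv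
    simp [hc] at this
  exact ((h.norm ℝ hne).inv fun v => norm_ne_zero_iff.2 (hne v)).smul h

lemma sphere_subset_iUnion_sphereChart (m : ℕ) :
    sphere (0 : EuclideanSpace ℝ (Fin (m + 1))) 1 ⊆
      ⋃ i : Fin (m + 1), sphereChart i 1 '' closedBall 0 1 ∪ sphereChart i (-1) '' closedBall 0 1 := by
  intro x hx
  have hx1 : ‖x‖ = 1 := by simpa using hx
  obtain ⟨i, hi⟩ := Finite.exists_max fun i => |x i|
  have hpos : 0 < |x i| := by
    by_contra! h
    have : x = 0 := by
      ext j
      exact abs_nonpos_iff.1 ((hi j).trans h)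
    simp [this] at hx1
  have key : ∀ c : ℝ, c * |x i| = x i →
      x ∈ sphereChart i c '' closedBall (0 : Fin m → ℝ) 1 := by
    intro c hc
    refine ⟨fun j => |x i|⁻¹ * x (i.succAbove j), ?_, ?_⟩
    · rw [mem_closedBall_zero_iff, pi_norm_le_iff_of_nonneg zero_le_one]
      intro j
      rw [norm_mul, norm_inv, Real.norm_eq_abs, Real.norm_eq_abs, abs_abs, inv_mul_le_one₀ hpos]
      exact hi _
    · have hz : (WithLp.toLp 2 (i.insertNth c (fun j => |x i|⁻¹ * x (i.succAbove j)) :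
          Fin (m + 1) → ℝ) : EuclideanSpace ℝ (Fin (m + 1))) = |x i|⁻¹ • x := by
        ext j
        refine i.succAboveCases ?_ (fun k => ?_) j
        · simp only [Fin.insertNth_apply_same, PiLp.smul_apply, smul_eq_mul]
          rw [eq_inv_mul_iff_mul_eq₀ hpos.ne', mul_comm, hc]
        · simp
      rw [sphereChart, hz, norm_smul, hx1, mul_one, norm_inv, norm_abs_eq_norm, inv_inv, smul_smul,
        Real.norm_eq_abs, mul_inv_cancel₀ hpos.ne', one_smul]
  refine Set.mem_iUnion.2 ⟨i, ?_⟩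
  rcases abs_choice (x i) with h | h
  · exact Or.inl (key 1 (by rw [one_mul, h]))
  · exact Or.inr (key (-1) (by rw [h]; ring))

lemma hausdorffMeasure_image_sphereChart_lt_top {m : ℕ} (i : Fin (m + 1)) {c : ℝ} (hc : c ≠ 0) :
    μH[m] (sphereChart i c '' closedBall 0 1) < ⊤ := by
  obtain ⟨K, hK⟩ := (contDiff_sphereChart i hc).contDiffOn.exists_lipschitzOnWith one_ne_zero
    (convex_closedBall (0 : Fin m → ℝ) 1) (isCompact_closedBall 0 1)
  refine (hK.hausdorffMeasure_image_le m.cast_nonneg).trans_lt (ENNReal.mul_lt_top ?_ ?_)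
  · exact ENNReal.rpow_lt_top_of_nonneg m.cast_nonneg ENNReal.coe_ne_top
  · have h : (μH[m] : Measure (Fin m → ℝ)) = volume := by
      simpa using hausdorffMeasure_pi_real (ι := Fin m)
    rw [h]
    exact measure_closedBall_lt_top

/-- The unit sphere of `ℝⁿ` has finite `(n - 1)`-dimensional Hausdorff measure. -/
lemma hausdorffMeasure_sphere_lt_top {n : ℕ} (hn : 1 ≤ n) :
    μH[(n : ℝ) - 1] (sphere (0 : EuclideanSpace ℝ (Fin n)) 1) < ⊤ := by
  obtain ⟨m, rfl⟩ := Nat.exists_eq_add_of_le' hn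
  rw [Nat.cast_add, Nat.cast_one, add_sub_cancel_right]
  refine (measure_mono (sphere_subset_iUnion_sphereChart m)).trans_lt ?_
  refine (measure_iUnion_fintype_le _ _).trans_lt (ENNReal.sum_lt_top.2 fun i _ => ?_)
  exact measure_union_lt_top (hausdorffMeasure_image_sphereChart_lt_top i one_ne_zero)
    (hausdorffMeasure_image_sphereChart_lt_top i (neg_ne_zero.2 one_ne_zero))

lemma abs_sub_rpow_le {p : ℝ} (hp : 1 ≤ p) (u v : ℝ) :
    |u - v| ^ p ≤ 2 ^ (p - 1) * (|u| ^ p + |v| ^ p) :=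
  (Real.rpow_le_rpow (abs_nonneg _) (abs_sub u v) (by linarith)).trans <| by
    have h := NNReal.rpow_add_le_mul_rpow_add_rpow ‖u‖₊ ‖v‖₊ hp
    exact_mod_cast h

lemma half_le_norm_sub_smul {E : Type*} [NormedAddCommGroup E] [NormedSpace ℝ E] {x y : E}
    (hx : ‖x‖ = 1) (hy : ‖y‖ = 1) {t : ℝ} (ht : t ∈ Set.Ioo (0 : ℝ) (1 / 2)) :
    1 / 2 ≤ ‖x - t • y‖ := by
  have h := norm_sub_norm_le x (t • y)
  rw [norm_smul, hx, hy, Real.norm_of_nonneg ht.1.le] at h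
  linarith [ht.2]

lemma kernel_integrand_le {E : Type*} [NormedAddCommGroup E] [NormedSpace ℝ E] {x y : E}
    (hx : ‖x‖ = 1) (hy : ‖y‖ = 1) {a b p q t : ℝ} (hp : 1 ≤ p) (hq : 0 ≤ q)
    (ht : t ∈ Set.Ioo (0 : ℝ) (1 / 2)) (u v : ℝ) :
    t ^ b * (|u - t ^ a * v| ^ p / ‖x - t • y‖ ^ q) ≤
      2 ^ q * 2 ^ (p - 1) * (t ^ b * |u| ^ p + t ^ (b + a * p) * |v| ^ p) := by
  have ht0 := ht.1
  have h1 : |u - t ^ a * v| ^ p ≤ 2 ^ (p - 1) * (|u| ^ p + t ^ (a * p) * |v| ^ p) := by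
    refine (abs_sub_rpow_le hp _ _).trans_eq ?_
    rw [abs_mul, Real.mul_rpow (abs_nonneg _) (abs_nonneg _),
      abs_of_nonneg (Real.rpow_nonneg ht0.le _), ← Real.rpow_mul ht0.le]
  have h2 : (1 / 2 : ℝ) ^ q ≤ ‖x - t • y‖ ^ q :=
    Real.rpow_le_rpow (by norm_num) (half_le_norm_sub_smul hx hy ht) hq
  calc t ^ b * (|u - t ^ a * v| ^ p / ‖x - t • y‖ ^ q)
      ≤ t ^ b * (2 ^ (p - 1) * (|u| ^ p + t ^ (a * p) * |v| ^ p) / (1 / 2) ^ q) := by gcongr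
    _ = _ := by
      rw [Real.rpow_add ht0, one_div, Real.inv_rpow zero_le_two, div_inv_eq_mul]
      ring

lemma lintegral_rpow_Ioo_lt_top {r : ℝ} (hr : -1 < r) (c : ℝ) :
    ∫⁻ t in Set.Ioo 0 c, ENNReal.ofReal (t ^ r) < ⊤ :=
  ((intervalIntegral.intervalIntegrable_rpow' hr (a := 0) (b := c)).1.mono_set
    Set.Ioo_subset_Ioc_self).lintegral_lt_top

lemma lintegral_kernel_le {E : Type*} [NormedAddCommGroup E] [NormedSpace ℝ E] {x y : E}
    (hx : ‖x‖ = 1) (hy : ‖y‖ = 1) {a b p q : ℝ} (hp : 1 ≤ p) (hq : 0 ≤ q) (u v : ℝ) :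
    ∫⁻ t in Set.Ioo (0 : ℝ) (1 / 2),
        ENNReal.ofReal (t ^ b * (|u - t ^ a * v| ^ p / ‖x - t • y‖ ^ q)) ≤
      ENNReal.ofReal (2 ^ q * 2 ^ (p - 1)) *
        ((∫⁻ t in Set.Ioo (0 : ℝ) (1 / 2), ENNReal.ofReal (t ^ b)) * ENNReal.ofReal (|u| ^ p) +
          (∫⁻ t in Set.Ioo (0 : ℝ) (1 / 2), ENNReal.ofReal (t ^ (b + a * p))) *
            ENNReal.ofReal (|v| ^ p)) := by
  have hm : ∀ r : ℝ, Measurable fun t : ℝ => ENNReal.ofReal (t ^ r) := fun r => by fun_prop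
  rw [← lintegral_mul_const _ (hm _), ← lintegral_mul_const _ (hm _),
    ← lintegral_add_left ((hm _).mul_const _),
    ← lintegral_const_mul _ (by fun_prop)]
  refine setLIntegral_mono' measurableSet_Ioo fun t ht => ?_
  have ht0 := ht.1.le
  rw [← ENNReal.ofReal_mul (by positivity), ← ENNReal.ofReal_mul (by positivity),
    ← ENNReal.ofReal_add (by positivity) (by positivity), ← ENNReal.ofReal_mul (by positivity)]
  exact ENNReal.ofReal_le_ofReal (kernel_integrand_le hx hy hp hq ht u v)

/-- A double integral of `K * (A * g x + B * g y)` over a set is a multiple of `∫ g`. -/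
lemma setLIntegral_setLIntegral_add {X : Type*} [MeasurableSpace X] (μ : Measure X) (S : Set X)
    {g : X → ENNReal} (hg : Measurable g) (K A B : ENNReal) :
    ∫⁻ x in S, ∫⁻ y in S, K * (A * g x + B * g y) ∂μ ∂μ =
      K * (A + B) * μ S * ∫⁻ x in S, g x ∂μ := by
  have h : ∀ x, ∫⁻ y in S, K * (A * g x + B * g y) ∂μ =
      K * (A * g x * μ S + B * ∫⁻ y in S, g y ∂μ) := fun x => by
    rw [lintegral_const_mul _ (by fun_prop), lintegral_add_left measurable_const,
      lintegral_const_mul _ hg, setLIntegral_const]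
  simp_rw [h]
  rw [lintegral_const_mul _ (by fun_prop), lintegral_add_right _ measurable_const,
    lintegral_mul_const _ (by fun_prop), lintegral_const_mul _ hg, setLIntegral_const]
  ring

/-- estimate of the contribution of `t ∈ (0, 1/2)` in the kernel integral:
`I₁ ≤ C ‖f‖_{L^p(∂B)}^p`. -/
theorem kernel_integral_small_t_estimate
    (n : ℕ) (hn : 2 ≤ n) (a s p : ℝ) (hs0 : 0 < s) (hs1 : s < 1)
    (hp : 1 ≤ p) (hnap : 0 < (n : ℝ) + a * p) :
    ∃ C : ℝ, 0 < C ∧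
      ∀ f : EuclideanSpace ℝ (Fin n) → ℝ, Measurable f →
        (∫⁻ x in sphere (0 : EuclideanSpace ℝ (Fin n)) 1,
          ∫⁻ y in sphere (0 : EuclideanSpace ℝ (Fin n)) 1,
            (∫⁻ t in Set.Ioo (0 : ℝ) (1 / 2),
              ENNReal.ofReal
                (t ^ ((n : ℝ) - 1) * (|f x - t ^ a * f y| ^ p
                  / ‖x - t • y‖ ^ ((n : ℝ) + s * p))))
          ∂μH[(n : ℝ) - 1] ∂μH[(n : ℝ) - 1])
        ≤ ENNReal.ofReal C *
            ∫⁻ x in sphere (0 : EuclideanSpace ℝ (Fin n)) 1,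
              ENNReal.ofReal (|f x| ^ p) ∂μH[(n : ℝ) - 1] := by
  set S := sphere (0 : EuclideanSpace ℝ (Fin n)) 1
  have hn' : (2 : ℝ) ≤ n := by exact_mod_cast hn
  have hq : 0 ≤ (n : ℝ) + s * p := by positivity
  set K := ENNReal.ofReal (2 ^ ((n : ℝ) + s * p) * 2 ^ (p - 1))
  set A := ∫⁻ t in Set.Ioo (0 : ℝ) (1 / 2), ENNReal.ofReal (t ^ ((n : ℝ) - 1))
  set B := ∫⁻ t in Set.Ioo (0 : ℝ) (1 / 2), ENNReal.ofReal (t ^ ((n : ℝ) - 1 + a * p))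
  have hD : K * (A + B) * μH[(n : ℝ) - 1] S < ⊤ :=
    ENNReal.mul_lt_top (ENNReal.mul_lt_top ENNReal.ofReal_lt_top (ENNReal.add_lt_top.2
      ⟨lintegral_rpow_Ioo_lt_top (by linarith) _, lintegral_rpow_Ioo_lt_top (by linarith) _⟩))
      (hausdorffMeasure_sphere_lt_top (by omega))
  refine ⟨(K * (A + B) * μH[(n : ℝ) - 1] S).toReal + 1, by positivity, fun f hf => ?_⟩
  calc _ ≤ ∫⁻ x in S, ∫⁻ y in S, K * (A * ENNReal.ofReal (|f x| ^ p) +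
          B * ENNReal.ofReal (|f y| ^ p)) ∂μH[(n : ℝ) - 1] ∂μH[(n : ℝ) - 1] :=
        setLIntegral_mono' isClosed_sphere.measurableSet fun x hx =>
          setLIntegral_mono' isClosed_sphere.measurableSet fun y hy =>
            lintegral_kernel_le (mem_sphere_zero_iff_norm.1 hx) (mem_sphere_zero_iff_norm.1 hy)
              hp hq _ _
    _ = K * (A + B) * μH[(n : ℝ) - 1] S *
          ∫⁻ x in S, ENNReal.ofReal (|f x| ^ p) ∂μH[(n : ℝ) - 1] :=
        setLIntegral_setLIntegral_add _ _ (g := fun x => ENNReal.ofReal (|f x| ^ p))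
          (by simp_rw [← Real.norm_eq_abs]; fun_prop) _ _ _
    _ ≤ _ := by
        gcongr
        exact (ENNReal.ofReal_toReal hD.ne).symm.trans_le
          (ENNReal.ofReal_le_ofReal (le_add_of_nonneg_right zero_le_one))
end

section
/- Let $0 < s < 1$, $1 \le p < \infty$ and $n \ge 2$. Then there exists a constant $C > 0$, depending only on $s, p, n$, such that for all $x, y$ on the Euclidean unit sphere $\partial B \subset \mathbb{R}^n$ with $x \ne y$ one has $\int_{1/2}^1 \frac{1}{|x - t\, y|^{n+sp}}\, dt \le \frac{C}{|x-y|^{n-1+sp}}$. -/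
open MeasureTheory Metric

/-- One-dimensional integral bound for the kernel `(d + 2 (1 - t)) ^ (-b)` with `b > 1`. -/
theorem lintegral_Icc_half_one_rpow_le {b d : ℝ} (hb : 1 < b) (hd : 0 < d) :
    (∫⁻ t in Set.Icc (1 / 2 : ℝ) 1, ENNReal.ofReal (4 ^ b * (d + 2 * (1 - t)) ^ (-b)))
      ≤ ENNReal.ofReal (4 ^ b / (2 * (b - 1)) / d ^ (b - 1)) := by
  have hb' : 0 < b - 1 := sub_pos.2 hb
  have hpos : ∀ t ∈ Set.Icc (1 / 2 : ℝ) 1, 0 < d + 2 * (1 - t) := fun t ht => by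
    linarith [ht.2]
  have hcont : ContinuousOn (fun t : ℝ => 4 ^ b * (d + 2 * (1 - t)) ^ (-b))
      (Set.Icc (1 / 2 : ℝ) 1) :=
    continuousOn_const.mul
      (ContinuousOn.rpow_const (by fun_prop) fun t ht => Or.inl (hpos t ht).ne')
  have hle : (1 / 2 : ℝ) ≤ 1 := by norm_num
  have hderiv : ∀ t ∈ Set.uIcc (1 / 2 : ℝ) 1,
      HasDerivAt (fun t : ℝ => 4 ^ b / (2 * (b - 1)) * (d + 2 * (1 - t)) ^ (-(b - 1)))
        (4 ^ b * (d + 2 * (1 - t)) ^ (-b)) t := fun t ht => by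
    rw [Set.uIcc_of_le hle] at ht
    have h1 : HasDerivAt (fun t : ℝ => d + 2 * (1 - t)) (-2) t := by
      simpa using (((hasDerivAt_id t).const_sub 1).const_mul 2).const_add d
    have h2 := (h1.rpow_const (p := -(b - 1)) (Or.inl (hpos t ht).ne')).const_mul
      (4 ^ b / (2 * (b - 1)))
    rw [show -(b - 1) - 1 = -b by ring] at h2
    refine h2.congr_deriv ?_
    field_simp
  rw [← ofReal_integral_eq_lintegral_ofReal hcont.integrableOn_Icc
    (ae_restrict_of_forall_mem measurableSet_Icc fun t ht => by
      have := hpos t ht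
      simp only [Pi.zero_apply]
      positivity)]
  apply ENNReal.ofReal_le_ofReal
  rw [integral_Icc_eq_integral_Ioc, ← intervalIntegral.integral_of_le hle,
    intervalIntegral.integral_eq_sub_of_hasDerivAt hderiv
      (ContinuousOn.intervalIntegrable (by rwa [Set.uIcc_of_le hle]))]
  have hF : 0 ≤ 4 ^ b / (2 * (b - 1)) * (d + 2 * (1 - 1 / 2)) ^ (-(b - 1)) := by positivity
  have hd1 : d + 2 * (1 - 1) = d := by ring
  rw [hd1, Real.rpow_neg hd.le (b - 1), ← div_eq_mul_inv]
  linarith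

/-- For unit vectors and `t ≤ 1`, the distance from `x` to `t • y` controls both
`‖x - y‖` and `1 - t`. -/
theorem norm_sub_add_le_four_mul_norm_sub_smul {E : Type*} [NormedAddCommGroup E]
    [NormedSpace ℝ E] {x y : E} (hx : ‖x‖ = 1) (hy : ‖y‖ = 1) {t : ℝ} (ht0 : 0 ≤ t)
    (ht1 : t ≤ 1) : ‖x - y‖ + 2 * (1 - t) ≤ 4 * ‖x - t • y‖ := by
  have h1 : 1 - t ≤ ‖x - t • y‖ := by
    have := norm_sub_norm_le x (t • y)
    rwa [norm_smul, hx, hy, Real.norm_of_nonneg ht0, mul_one] at this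
  have h2 : ‖x - y‖ ≤ ‖x - t • y‖ + (1 - t) := by
    have h : x - y = (x - t • y) - (1 - t) • y := by
      rw [sub_smul, one_smul]
      abel
    calc ‖x - y‖ = ‖(x - t • y) - (1 - t) • y‖ := by rw [← h]
      _ ≤ ‖x - t • y‖ + ‖(1 - t) • y‖ := norm_sub_le _ _
      _ = ‖x - t • y‖ + (1 - t) := by
        rw [norm_smul, hy, Real.norm_of_nonneg (sub_nonneg.2 ht1), mul_one]
  linarith


/-- the pointwise kernel estimate
`∫_{1/2}^1 dt / |x - t y|^{n+sp} ≤ C / |x-y|^{n-1+sp}` for `x ≠ y` on the unit sphere. -/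
theorem kernel_t_integral_pointwise_estimate
    (n : ℕ) (hn : 2 ≤ n) (s p : ℝ) (hs0 : 0 < s) (hs1 : s < 1) (hp : 1 ≤ p) :
    ∃ C : ℝ, 0 < C ∧
      ∀ x y : EuclideanSpace ℝ (Fin n),
        x ∈ sphere (0 : EuclideanSpace ℝ (Fin n)) 1 →
        y ∈ sphere (0 : EuclideanSpace ℝ (Fin n)) 1 → x ≠ y →
        (∫⁻ t in Set.Icc (1 / 2 : ℝ) 1,
            ENNReal.ofReal (1 / ‖x - t • y‖ ^ ((n : ℝ) + s * p)))
          ≤ ENNReal.ofReal (C / ‖x - y‖ ^ ((n : ℝ) - 1 + s * p)) := by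
  have hb : 1 < (n : ℝ) + s * p := by
    have : (2 : ℝ) ≤ n := by exact_mod_cast hn
    have : 0 < s * p := by positivity
    linarith
  refine ⟨4 ^ ((n : ℝ) + s * p) / (2 * ((n : ℝ) + s * p - 1)),
    div_pos (by positivity) (by linarith), fun x y hx hy hxy => ?_⟩
  rw [mem_sphere_zero_iff_norm] at hx hy
  have hd : 0 < ‖x - y‖ := norm_pos_iff.2 (sub_ne_zero.2 hxy)
  rw [show (n : ℝ) - 1 + s * p = n + s * p - 1 by ring]
  refine le_trans (setLIntegral_mono' measurableSet_Icc fun t ht => ?_)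
    (lintegral_Icc_half_one_rpow_le hb hd)
  apply ENNReal.ofReal_le_ofReal
  have hA : 0 < ‖x - y‖ + 2 * (1 - t) := by linarith [ht.2]
  have hle := norm_sub_add_le_four_mul_norm_sub_smul hx hy (by linarith [ht.1]) ht.2
  have hpow := Real.rpow_le_rpow hA.le hle (by linarith : 0 ≤ (n : ℝ) + s * p)
  rw [Real.mul_rpow (by norm_num) (norm_nonneg _)] at hpow
  have hN : 0 < ‖x - t • y‖ := by linarith
  rw [Real.rpow_neg hA.le, ← div_eq_mul_inv, div_le_div_iff₀ (by positivity) (by positivity),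
    one_mul]
  exact hpow
end

section
/- Let $0 < s < 1$, $1 \le p < \infty$ and $n \ge 2$. Then there exists a constant $C > 0$, depending only on $s, p, n$, such that for every measurable function $f : \partial B \to \mathbb{R}$ one has $\int_{\partial B}\int_{\partial B}\int_{1/2}^1 \frac{|f(x)-f(y)|^p}{|x - t\,y|^{n+sp}}\, dt\, d\sigma(x)\, d\sigma(y) \le C \int_{\partial B}\int_{\partial B} \frac{|f(x)-f(y)|^p}{|x-y|^{n-1+sp}}\, d\sigma(x)\, d\sigma(y)$, where both sides are interpreted as values in $[0,\infty]$. -/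
open MeasureTheory Metric

lemma integral_rpow_sub_le {a d : ℝ} (ha : 0 < a) (hd : 0 < d) :
    ∫ t in (1 / 2 : ℝ)..1, (1 + d - t) ^ (-(a + 1)) ≤ d ^ (-a) / a := by
  rw [intervalIntegral.integral_comp_sub_left (fun u : ℝ => u ^ (-(a + 1))) (1 + d),
    integral_rpow]
  · have h1 : -(a + 1) + 1 = -a := by ring
    have h2 : 1 + d - 1 = d := by ring
    rw [h1, h2, div_neg, ← neg_div]
    have h3 : 0 ≤ (1 + d - 1 / 2) ^ (-a) := Real.rpow_nonneg (by linarith) _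
    gcongr
    linarith
  · refine Or.inr ⟨by linarith, ?_⟩
    rw [Set.uIcc_of_le (by linarith)]
    intro h
    linarith [h.1]

lemma lintegral_rpow_sub_le {a d : ℝ} (ha : 0 < a) (hd : 0 < d) :
    ∫⁻ t in Set.Icc (1 / 2 : ℝ) 1, ENNReal.ofReal ((1 + d - t) ^ (-(a + 1)))
      ≤ ENNReal.ofReal (d ^ (-a) / a) := by
  have hpos : ∀ t ∈ Set.Icc (1 / 2 : ℝ) 1, 0 < 1 + d - t := fun t ht => by linarith [ht.2]
  have hcont : ContinuousOn (fun t : ℝ => (1 + d - t) ^ (-(a + 1))) (Set.Icc (1 / 2) 1) :=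
    ContinuousOn.rpow_const (by fun_prop) fun t ht => Or.inl (hpos t ht).ne'
  rw [← ofReal_integral_eq_lintegral_ofReal hcont.integrableOn_Icc
    ((ae_restrict_iff' measurableSet_Icc).2 (ae_of_all _ fun t ht =>
      Real.rpow_nonneg (hpos t ht).le _)), integral_Icc_eq_integral_Ioc,
    ← intervalIntegral.integral_of_le (by norm_num)]
  exact ENNReal.ofReal_le_ofReal (integral_rpow_sub_le ha hd)

lemma norm_sub_smul_ge {E : Type*} [NormedAddCommGroup E] [NormedSpace ℝ E] {x y : E}
    (hx : ‖x‖ = 1) (hy : ‖y‖ = 1) {t : ℝ} (ht0 : 0 ≤ t) (ht1 : t ≤ 1) :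
    (1 + ‖x - y‖ / 2 - t) / 2 ≤ ‖x - t • y‖ := by
  have h1 : 1 - t ≤ ‖x - t • y‖ := by
    have h := norm_sub_norm_le x (t • y)
    rwa [norm_smul, hx, hy, Real.norm_of_nonneg ht0, mul_one] at h
  have h2 : ‖x - y‖ ≤ ‖x - t • y‖ + (1 - t) := by
    have h := norm_sub_le (x - t • y) ((1 - t) • y)
    rwa [show x - t • y - (1 - t) • y = x - y by module, norm_smul, hy,
      Real.norm_of_nonneg (by linarith), mul_one] at h
  linarith

/-- Integrating the kernel `‖x - t y‖ ^ (-(a + 1))` in `t` gains one power of `‖x - y‖`. -/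
lemma lintegral_div_norm_sub_smul_rpow_le {E : Type*} [NormedAddCommGroup E] [NormedSpace ℝ E]
    {x y : E} (hx : ‖x‖ = 1) (hy : ‖y‖ = 1) (hxy : x ≠ y) {a A : ℝ} (ha : 0 < a) (hA : 0 ≤ A) :
    ∫⁻ t in Set.Icc (1 / 2 : ℝ) 1, ENNReal.ofReal (A / ‖x - t • y‖ ^ (a + 1))
      ≤ ENNReal.ofReal (2 ^ (a + 1) * 2 ^ a / a) * ENNReal.ofReal (A / ‖x - y‖ ^ a) := by
  have hr : 0 < ‖x - y‖ := norm_pos_iff.2 (sub_ne_zero.2 hxy)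
  have hd : 0 < ‖x - y‖ / 2 := by positivity
  calc
    _ ≤ ∫⁻ t in Set.Icc (1 / 2 : ℝ) 1, ENNReal.ofReal (A * 2 ^ (a + 1)) *
          ENNReal.ofReal ((1 + ‖x - y‖ / 2 - t) ^ (-(a + 1))) := by
      refine setLIntegral_mono' measurableSet_Icc fun t ht => ?_
      have hu : 0 < 1 + ‖x - y‖ / 2 - t := by linarith [ht.2]
      rw [← ENNReal.ofReal_mul (by positivity)]
      refine ENNReal.ofReal_le_ofReal ?_
      calc
        A / ‖x - t • y‖ ^ (a + 1) ≤ A / ((1 + ‖x - y‖ / 2 - t) / 2) ^ (a + 1) := by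
          gcongr
          exact norm_sub_smul_ge hx hy (by linarith [ht.1]) ht.2
        _ = A * 2 ^ (a + 1) * (1 + ‖x - y‖ / 2 - t) ^ (-(a + 1)) := by
          rw [Real.div_rpow hu.le zero_le_two, Real.rpow_neg hu.le]
          field_simp
    _ ≤ ENNReal.ofReal (A * 2 ^ (a + 1)) * ENNReal.ofReal ((‖x - y‖ / 2) ^ (-a) / a) := by
      rw [lintegral_const_mul' _ _ ENNReal.ofReal_ne_top]
      gcongr
      exact lintegral_rpow_sub_le ha hd
    _ = _ := by
      rw [← ENNReal.ofReal_mul (by positivity), ← ENNReal.ofReal_mul (by positivity),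
        Real.rpow_neg hd.le, Real.div_rpow hr.le zero_le_two]
      congr 1
      field_simp

/-- estimate `I₂ ≤ C |f|_{W^{s,p}(∂B)}^p` for the contribution of
`t ∈ (1/2, 1)` with kernel `|f(x)-f(y)|^p / |x - t y|^{n+sp}`. -/
theorem kernel_integral_I2_estimate
    (n : ℕ) (hn : 2 ≤ n) (s p : ℝ) (hs0 : 0 < s) (hs1 : s < 1) (hp : 1 ≤ p) :
    ∃ C : ℝ, 0 < C ∧
      ∀ f : EuclideanSpace ℝ (Fin n) → ℝ, Measurable f →
        (∫⁻ x in sphere (0 : EuclideanSpace ℝ (Fin n)) 1,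
          ∫⁻ y in sphere (0 : EuclideanSpace ℝ (Fin n)) 1,
            (∫⁻ t in Set.Icc (1 / 2 : ℝ) 1,
              ENNReal.ofReal (|f x - f y| ^ p / ‖x - t • y‖ ^ ((n : ℝ) + s * p)))
          ∂μH[(n : ℝ) - 1] ∂μH[(n : ℝ) - 1])
        ≤ ENNReal.ofReal C *
            ∫⁻ x in sphere (0 : EuclideanSpace ℝ (Fin n)) 1,
              ∫⁻ y in sphere (0 : EuclideanSpace ℝ (Fin n)) 1,
                ENNReal.ofReal (|f x - f y| ^ p / ‖x - y‖ ^ ((n : ℝ) - 1 + s * p))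
              ∂μH[(n : ℝ) - 1] ∂μH[(n : ℝ) - 1] := by
  have hn' : (2 : ℝ) ≤ n := by exact_mod_cast hn
  have hsp : 0 < s * p := by positivity
  have ha : 0 < (n : ℝ) - 1 + s * p := by linarith
  refine ⟨2 ^ ((n : ℝ) - 1 + s * p + 1) * 2 ^ ((n : ℝ) - 1 + s * p) / ((n : ℝ) - 1 + s * p),
    by positivity, fun f _ => ?_⟩
  rw [← lintegral_const_mul' _ _ ENNReal.ofReal_ne_top]
  refine setLIntegral_mono' isClosed_sphere.measurableSet fun x hx => ?_
  rw [← lintegral_const_mul' _ _ ENNReal.ofReal_ne_top]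
  refine setLIntegral_mono' isClosed_sphere.measurableSet fun y hy => ?_
  rw [mem_sphere_zero_iff_norm] at hx hy
  rcases eq_or_ne x y with rfl | hxy
  · simp [Real.zero_rpow (by linarith : p ≠ 0)]
  · have h := lintegral_div_norm_sub_smul_rpow_le hx hy hxy ha
      (Real.rpow_nonneg (abs_nonneg (f x - f y)) p)
    rwa [show (n : ℝ) - 1 + s * p + 1 = n + s * p by ring] at h ⊢
end

section
/- Let $a \in \mathbb{R}$, $0 < s < 1$, $1 \le p < \infty$ and $n \ge 2$. Then there exists a constant $C > 0$, depending only on $a, s, p, n$, such that for every measurable function $f : \partial B \to \mathbb{R}$ one has $\int_{\partial B}\int_{\partial B}\int_{1/2}^1 \frac{|1 - t^a|^p\, |f(y)|^p}{|x - t\,y|^{n+sp}}\, dt\, d\sigma(x)\, d\sigma(y) \le C \int_{\partial B} |f|^p \, d\sigma$, where both sides are interpreted as values in $[0,\infty]$. -/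
open MeasureTheory Metric

open scoped ENNReal NNReal

section Hausdorff

variable {X Y : Type*} [MetricSpace X] [MeasurableSpace X] [BorelSpace X]
  [MetricSpace Y] [MeasurableSpace Y] [BorelSpace Y]

lemma hausdorffMeasure_le_image_of_dist_le {g : X → Y} {A : Set X} {K : ℝ≥0} {d : ℝ} (hd : 0 ≤ d)
    (h : ∀ x ∈ A, ∀ y ∈ A, dist x y ≤ K * dist (g x) (g y)) :
    μH[d] A ≤ (K : ℝ≥0∞) ^ d * μH[d] (g '' A) := by
  have hg : AntilipschitzWith K (A.domRestrict g) :=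
    AntilipschitzWith.of_le_mul_dist fun x y => h x x.2 y y.2
  have h1 := hg.le_hausdorffMeasure_image hd Set.univ
  have h2 := (isometry_subtype_coe (s := A)).hausdorffMeasure_image (Or.inl hd) Set.univ
  rw [Set.image_univ, Subtype.range_coe] at h2
  rwa [← h2, Set.image_univ, Set.range_domRestrict] at h1

end Hausdorff

section SphereCharts

variable {n : ℕ}

/-- The part of the unit sphere on which the `i`-th coordinate is bounded away from zero
with the sign of `e`. -/
def spherePatch (n : ℕ) (i : Fin n) (e : ℝ) : Set (EuclideanSpace ℝ (Fin n)) :=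
  {x | ‖x‖ = 1 ∧ 1 / (n : ℝ) ≤ e * x i}

/-- Forget the `i`-th coordinate. -/
def dropCoord (i : Fin n) (x : EuclideanSpace ℝ (Fin n)) : {j // j ≠ i} → ℝ := fun j => x j

lemma exists_mem_spherePatch {x : EuclideanSpace ℝ (Fin n)} (hx : ‖x‖ = 1) :
    ∃ i, x ∈ spherePatch n i 1 ∪ spherePatch n i (-1) := by
  have hsum : ∑ i, ‖x i‖ ^ 2 = 1 := by rw [← EuclideanSpace.norm_sq_eq, hx, one_pow]
  have hn : 0 < n := by
    rcases Nat.eq_zero_or_pos n with rfl | h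
    · simp at hsum
    · exact h
  obtain ⟨i, -, hi⟩ : ∃ i ∈ (Finset.univ : Finset (Fin n)), 1 / (n : ℝ) ≤ ‖x i‖ ^ 2 := by
    have : Nonempty (Fin n) := ⟨⟨0, hn⟩⟩
    apply Finset.exists_le_of_sum_le Finset.univ_nonempty
    rw [hsum]
    have : (n : ℝ) ≠ 0 := by positivity
    simp [this]
  have h1 : ‖x i‖ ≤ 1 := hx ▸ PiLp.norm_apply_le x i
  have h2 : 1 / (n : ℝ) ≤ |x i| := by
    rw [Real.norm_eq_abs] at *
    nlinarith [abs_nonneg (x i)]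
  refine ⟨i, ?_⟩
  rcases le_abs.1 h2 with h | h
  · exact Or.inl ⟨hx, by simpa using h⟩
  · exact Or.inr ⟨hx, by simpa using h⟩

lemma dist_le_dist_dropCoord {i : Fin n} {e : ℝ} (he : |e| = 1)
    {x y : EuclideanSpace ℝ (Fin n)} (hx : x ∈ spherePatch n i e) (hy : y ∈ spherePatch n i e) :
    dist x y ≤ (n : ℝ) ^ 3 * dist (dropCoord i x) (dropCoord i y) := by
  set η := dist (dropCoord i x) (dropCoord i y) with hη
  have hη0 : 0 ≤ η := dist_nonneg
  have hn : (1 : ℝ) ≤ n := by exact_mod_cast Fin.pos i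
  have hj : ∀ j, j ≠ i → |x j - y j| ≤ η := fun j hj => by
    simpa [Real.dist_eq, dropCoord] using
      dist_le_pi_dist (dropCoord i x) (dropCoord i y) ⟨j, hj⟩
  have hxn : ∀ j, |x j| ≤ 1 := fun j => by simpa [hx.1] using PiLp.norm_apply_le x j
  have hyn : ∀ j, |y j| ≤ 1 := fun j => by simpa [hy.1] using PiLp.norm_apply_le y j
  have hsx : ∑ j, x j ^ 2 = 1 := by simpa [hx.1] using (EuclideanSpace.norm_sq_eq x).symm
  have hsy : ∑ j, y j ^ 2 = 1 := by simpa [hy.1] using (EuclideanSpace.norm_sq_eq y).symm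
  have hsq : |x i ^ 2 - y i ^ 2| ≤ 2 * n * η := by
    rw [← Finset.add_sum_erase _ _ (Finset.mem_univ i)] at hsx hsy
    have : x i ^ 2 - y i ^ 2 = ∑ j ∈ Finset.univ.erase i, (y j ^ 2 - x j ^ 2) := by
      rw [Finset.sum_sub_distrib]; linarith
    rw [this]
    have hc : ((Finset.univ.erase i).card : ℝ) ≤ n := by
      exact_mod_cast (Finset.card_le_univ _).trans_eq (Fintype.card_fin n)
    calc _ ≤ ∑ j ∈ Finset.univ.erase i, |y j ^ 2 - x j ^ 2| := Finset.abs_sum_le_sum_abs _ _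
      _ ≤ ∑ j ∈ Finset.univ.erase i, 2 * η := by
        refine Finset.sum_le_sum fun j hjm => ?_
        have h1 := hj j (Finset.ne_of_mem_erase hjm)
        have h2 : |x j + y j| ≤ 2 := (abs_add_le _ _).trans (by linarith [hxn j, hyn j])
        rw [abs_sub_comm, sq_sub_sq, abs_mul]
        exact mul_le_mul h2 h1 (abs_nonneg _) (by norm_num)
      _ = (Finset.univ.erase i).card * (2 * η) := by rw [Finset.sum_const, nsmul_eq_mul]
      _ ≤ n * (2 * η) := by gcongr
      _ = _ := by ring
  have hi : |x i - y i| ≤ n ^ 2 * η := by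
    have h1 : 2 / (n : ℝ) ≤ |x i + y i| := by
      calc 2 / (n : ℝ) = 1 / n + 1 / n := by ring
        _ ≤ e * (x i + y i) := by rw [mul_add]; exact add_le_add hx.2 hy.2
        _ ≤ |e * (x i + y i)| := le_abs_self _
        _ = |x i + y i| := by rw [abs_mul, he, one_mul]
    rw [sq_sub_sq, abs_mul] at hsq
    have h2 : 2 / (n : ℝ) * |x i - y i| ≤ 2 * n * η :=
      (mul_le_mul_of_nonneg_right h1 (abs_nonneg _)).trans hsq
    have h3 : (n : ℝ) / 2 * (2 / n * |x i - y i|) = |x i - y i| := by field_simp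
    calc _ = (n : ℝ) / 2 * (2 / n * |x i - y i|) := h3.symm
      _ ≤ n / 2 * (2 * n * η) := by gcongr
      _ = _ := by ring
  have hall : ∀ j, |x j - y j| ≤ n ^ 2 * η := fun j => by
    by_cases h : j = i
    · exact h ▸ hi
    · have : (1 : ℝ) ≤ (n : ℝ) ^ 2 := one_le_pow₀ hn
      nlinarith [hj j h]
  rw [EuclideanSpace.dist_eq]
  apply Real.sqrt_le_iff.2 ⟨by positivity, ?_⟩
  calc ∑ j, dist (x j) (y j) ^ 2 ≤ ∑ j : Fin n, (n ^ 2 * η) ^ 2 :=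
        Finset.sum_le_sum fun j _ => by
          rw [Real.dist_eq]; exact pow_le_pow_left₀ (abs_nonneg _) (hall j) 2
    _ = n * (n ^ 2 * η) ^ 2 := by simp
    _ ≤ n ^ 2 * (n ^ 2 * η) ^ 2 := by gcongr; nlinarith
    _ = _ := by ring

lemma hausdorffMeasure_spherePatch_inter_closedBall_le {i : Fin n} {e : ℝ} (he : |e| = 1)
    (y : EuclideanSpace ℝ (Fin n)) {r : ℝ} (hr : 0 ≤ r) :
    μH[(n : ℝ) - 1] (spherePatch n i e ∩ closedBall y r) ≤
      ENNReal.ofReal ((n : ℝ) ^ 3) ^ ((n : ℝ) - 1) * ENNReal.ofReal ((2 * r) ^ (n - 1)) := by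
  have hn : 1 ≤ n := Fin.pos i
  have hcard : Fintype.card {j // j ≠ i} = n - 1 := by simp
  have hcast : (n : ℝ) - 1 = (Fintype.card {j // j ≠ i} : ℝ) := by
    rw [hcard]; push_cast [hn]; rfl
  have hd : (0 : ℝ) ≤ (n : ℝ) - 1 := by rw [hcast]; positivity
  refine (hausdorffMeasure_le_image_of_dist_le (g := dropCoord i)
    (K := ((n : ℝ) ^ 3).toNNReal) hd fun x hx z hz => ?_).trans ?_
  · rw [Real.coe_toNNReal _ (by positivity)]
    exact dist_le_dist_dropCoord he hx.1 hz.1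
  · refine mul_le_mul_right ?_ _
    have himg : dropCoord i '' (spherePatch n i e ∩ closedBall y r) ⊆
        closedBall (dropCoord i y) r := by
      rintro _ ⟨x, ⟨-, hx⟩, rfl⟩
      refine (dist_pi_le_iff hr).2 fun j => ?_
      rw [mem_closedBall, dist_eq_norm] at hx
      exact (PiLp.norm_apply_le (x - y) j).trans hx
    calc _ ≤ μH[(n : ℝ) - 1] (closedBall (dropCoord i y) r) := measure_mono himg
      _ = volume (closedBall (dropCoord i y) r) := by rw [hcast, hausdorffMeasure_pi_real]
      _ = _ := by rw [Real.volume_pi_closedBall _ hr, hcard]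

/-- The unit sphere is upper Ahlfors regular of dimension `n - 1`. -/
lemma exists_hausdorffMeasure_sphere_inter_closedBall_le (n : ℕ) :
    ∃ C : ℝ≥0∞, C ≠ ∞ ∧ ∀ (y : EuclideanSpace ℝ (Fin n)) (r : ℝ), 0 ≤ r →
      μH[(n : ℝ) - 1] (sphere 0 1 ∩ closedBall y r) ≤ C * ENNReal.ofReal (r ^ (n - 1)) := by
  rcases Nat.eq_zero_or_pos n with rfl | hn
  · refine ⟨0, ENNReal.zero_ne_top, fun y r _ => ?_⟩
    have : (sphere (0 : EuclideanSpace ℝ (Fin 0)) 1) = ∅ := by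
      ext x; simp [Subsingleton.elim x 0]
    simp [this]
  have hn1 : (0 : ℝ) ≤ (n : ℝ) - 1 := by
    have : (1 : ℝ) ≤ n := by exact_mod_cast hn
    linarith
  set K : ℝ≥0∞ := ENNReal.ofReal ((n : ℝ) ^ 3) ^ ((n : ℝ) - 1) with hK
  refine ⟨n * (2 * (K * ENNReal.ofReal (2 ^ (n - 1)))), ?_, fun y r hr => ?_⟩
  · have : K ≠ ∞ := ENNReal.rpow_ne_top_of_nonneg hn1 ENNReal.ofReal_ne_top
    finiteness
  have hsub : sphere (0 : EuclideanSpace ℝ (Fin n)) 1 ∩ closedBall y r ⊆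
      ⋃ i, (spherePatch n i 1 ∩ closedBall y r ∪ spherePatch n i (-1) ∩ closedBall y r) := by
    rintro x ⟨hx, hxr⟩
    obtain ⟨i, hi⟩ := exists_mem_spherePatch (mem_sphere_zero_iff_norm.1 hx)
    exact Set.mem_iUnion.2 ⟨i, hi.imp (⟨·, hxr⟩) (⟨·, hxr⟩)⟩
  calc _ ≤ ∑ i : Fin n, (K * ENNReal.ofReal ((2 * r) ^ (n - 1)) +
          K * ENNReal.ofReal ((2 * r) ^ (n - 1))) := by
        refine (measure_mono hsub).trans ((measure_iUnion_fintype_le _ _).trans ?_)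
        refine Finset.sum_le_sum fun i _ => (measure_union_le _ _).trans (add_le_add ?_ ?_)
        · exact hausdorffMeasure_spherePatch_inter_closedBall_le (by simp) y hr
        · exact hausdorffMeasure_spherePatch_inter_closedBall_le (by simp) y hr
    _ = _ := by
        rw [mul_pow, ENNReal.ofReal_mul (by positivity), Finset.sum_const, Finset.card_univ,
          Fintype.card_fin, nsmul_eq_mul]
        ring

end SphereCharts

section DyadicKernel

variable {n : ℕ}

/-- A dyadic majorant of `(x, y) ↦ ‖x - y‖ ^ (-β)` on the unit sphere, infinite on the diagonal. -/
noncomputable def dyadicKernel (β : ℝ) (x y : EuclideanSpace ℝ (Fin n)) : ℝ≥0∞ :=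
  ∑' k : ℕ, ENNReal.ofReal (2 ^ (k * β)) *
    {q : EuclideanSpace ℝ (Fin n) × EuclideanSpace ℝ (Fin n) |
      dist q.1 q.2 ≤ 4 * (1 / 2) ^ k}.indicator 1 (x, y)

lemma measurableSet_dist_le (r : ℝ) :
    MeasurableSet {q : EuclideanSpace ℝ (Fin n) × EuclideanSpace ℝ (Fin n) |
      dist q.1 q.2 ≤ r} :=
  measurableSet_le (by fun_prop) measurable_const

lemma measurable_dyadicKernel (β : ℝ) :
    Measurable fun q : EuclideanSpace ℝ (Fin n) × EuclideanSpace ℝ (Fin n) =>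
      dyadicKernel β q.1 q.2 :=
  Measurable.tsum fun _ =>
    (measurable_one.indicator (measurableSet_dist_le _)).const_mul _

lemma exists_lintegral_dyadicKernel_le {β : ℝ} (hn : 1 ≤ n) (hβ : β < (n : ℝ) - 1) :
    ∃ N : ℝ≥0∞, N ≠ ∞ ∧ ∀ y : EuclideanSpace ℝ (Fin n),
      ∫⁻ x in sphere (0 : EuclideanSpace ℝ (Fin n)) 1, dyadicKernel β x y ∂μH[(n : ℝ) - 1] ≤ N := by
  obtain ⟨C, hC, hball⟩ := exists_hausdorffMeasure_sphere_inter_closedBall_le n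
  set ρ : ℝ := 2 ^ (β - ((n : ℝ) - 1)) with hρ
  have hρ1 : ρ < 1 := Real.rpow_lt_one_of_one_lt_of_neg (by norm_num) (by linarith)
  refine ⟨C * ENNReal.ofReal (4 ^ (n - 1)) * (1 - ENNReal.ofReal ρ)⁻¹, ?_, fun y => ?_⟩
  · have : (1 - ENNReal.ofReal ρ)⁻¹ ≠ ∞ := by
      simpa [tsub_eq_zero_iff_le] using hρ1
    finiteness
  have hterm : ∀ k : ℕ, (2 : ℝ) ^ (k * β) * (4 * (1 / 2) ^ k) ^ (n - 1) = 4 ^ (n - 1) * ρ ^ k := by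
    intro k
    have h1 : ρ ^ k = 2 ^ (k * β) * ((1 / 2 : ℝ) ^ k) ^ (n - 1) := by
      have h2 : ((1 / 2 : ℝ) ^ k) ^ (n - 1) = 2 ^ (-((n : ℝ) - 1) * k) := by
        rw [← pow_mul, one_div, inv_pow, ← Real.rpow_natCast, ← Real.rpow_neg (by norm_num)]
        congr 1; push_cast [hn]; ring
      rw [h2, ← Real.rpow_add (by norm_num), hρ, ← Real.rpow_mul_natCast (by norm_num)]
      congr 1; ring
    rw [h1, mul_pow]; ring
  calc _ = ∑' k : ℕ, ENNReal.ofReal (2 ^ (k * β)) *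
          μH[(n : ℝ) - 1] (sphere 0 1 ∩ closedBall y (4 * (1 / 2) ^ k)) := by
        simp only [dyadicKernel]
        have hm : ∀ k : ℕ, Measurable fun x : EuclideanSpace ℝ (Fin n) =>
            {q : EuclideanSpace ℝ (Fin n) × EuclideanSpace ℝ (Fin n) |
              dist q.1 q.2 ≤ 4 * (1 / 2) ^ k}.indicator
              (1 : EuclideanSpace ℝ (Fin n) × EuclideanSpace ℝ (Fin n) → ℝ≥0∞) (x, y) := fun k =>
          (measurable_one.indicator (measurableSet_dist_le _)).comp measurable_prodMk_right
        rw [lintegral_tsum fun k => ((hm k).const_mul _).aemeasurable]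
        refine tsum_congr fun k => ?_
        rw [lintegral_const_mul _ (hm k)]
        congr 1
        have : (fun x : EuclideanSpace ℝ (Fin n) =>
            {q : EuclideanSpace ℝ (Fin n) × EuclideanSpace ℝ (Fin n) |
              dist q.1 q.2 ≤ 4 * (1 / 2) ^ k}.indicator
              (1 : EuclideanSpace ℝ (Fin n) × EuclideanSpace ℝ (Fin n) → ℝ≥0∞) (x, y)) =
            (closedBall y (4 * (1 / 2) ^ k)).indicator 1 := by
          rfl
        rw [this, lintegral_indicator_one isClosed_closedBall.measurableSet,
          Measure.restrict_apply isClosed_closedBall.measurableSet, Set.inter_comm]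
    _ ≤ ∑' k : ℕ, C * ENNReal.ofReal (4 ^ (n - 1)) * ENNReal.ofReal ρ ^ k := by
        refine ENNReal.tsum_le_tsum fun k => ?_
        calc _ ≤ ENNReal.ofReal (2 ^ (k * β)) *
              (C * ENNReal.ofReal ((4 * (1 / 2) ^ k) ^ (n - 1))) := by
              gcongr; exact hball y _ (by positivity)
          _ = C * ENNReal.ofReal (2 ^ (k * β) * (4 * (1 / 2) ^ k) ^ (n - 1)) := by
              rw [ENNReal.ofReal_mul (by positivity)]; ring
          _ = _ := by
              rw [hterm, ENNReal.ofReal_mul (by positivity),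
                ENNReal.ofReal_pow (p := ρ) (by positivity), mul_assoc]
    _ = _ := by rw [ENNReal.tsum_mul_left, ENNReal.tsum_geometric]

lemma ofReal_rpow_neg_norm_le_dyadicKernel {β D : ℝ} (hβ : 0 ≤ β) (hD0 : 0 < D) (hD : D ≤ 2)
    {x y : EuclideanSpace ℝ (Fin n)} (hxy : dist x y ≤ 2 * D) :
    ENNReal.ofReal (D ^ (-β)) ≤ dyadicKernel β x y := by
  obtain ⟨k, hk1, hk2⟩ := exists_nat_pow_near_of_lt_one (x := D / 2) (y := (1 / 2 : ℝ))
    (by positivity) (by linarith) (by norm_num) (by norm_num)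
  refine le_trans ?_ (ENNReal.le_tsum k)
  rw [Set.indicator_of_mem (by simp only [Set.mem_ofPred_eq]; linarith), Pi.one_apply, mul_one]
  refine ENNReal.ofReal_le_ofReal ?_
  have h1 : (1 / 2 : ℝ) ^ k ≤ D := by rw [pow_succ] at hk1; linarith
  calc D ^ (-β) ≤ ((1 / 2 : ℝ) ^ k) ^ (-β) :=
        Real.rpow_le_rpow_of_nonpos (by positivity) h1 (by linarith)
    _ = 2 ^ (k * β) := by
        rw [one_div, inv_pow, Real.inv_rpow (by positivity), Real.rpow_neg (by positivity), inv_inv,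
          Real.rpow_mul (by norm_num), Real.rpow_natCast]

lemma kernel_le_dyadicKernel {a p β γ L F t : ℝ} (hp : 0 < p) (hβ : 0 ≤ β) (hγ : 0 ≤ γ)
    (hL : 0 ≤ L) (hF : 0 ≤ F) (ht : t ∈ Set.Icc (1 / 2 : ℝ) 1) (hta : |1 - t ^ a| ≤ L * (1 - t))
    {x y : EuclideanSpace ℝ (Fin n)} (hx : ‖x‖ = 1) (hy : ‖y‖ = 1) :
    ENNReal.ofReal (|1 - t ^ a| ^ p * F / ‖x - t • y‖ ^ (β + γ)) ≤
      ENNReal.ofReal F * dyadicKernel β x y * ENNReal.ofReal (L ^ p * (1 - t) ^ (p - γ)) := by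
  rcases ht.2.eq_or_lt with rfl | ht1
  · simp [Real.zero_rpow hp.ne']
  have hτ : 0 < 1 - t := by linarith
  have hnt : ‖t • y‖ = t := by
    rw [norm_smul, hy, mul_one, Real.norm_of_nonneg (by linarith [ht.1])]
  set D := ‖x - t • y‖ with hD
  have hDτ : 1 - t ≤ D := by
    simpa [hx, hnt] using norm_sub_norm_le x (t • y)
  have hD0 : 0 < D := hτ.trans_le hDτ
  have hD2 : D ≤ 2 := (norm_sub_le _ _).trans (by rw [hx, hnt]; linarith)
  have hxy : dist x y ≤ 2 * D := by
    have h1 : ‖t • y - y‖ = 1 - t := by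
      rw [show t • y - y = (t - 1) • y by rw [sub_smul, one_smul], norm_smul, hy, mul_one,
        Real.norm_eq_abs, abs_sub_comm, abs_of_pos hτ]
    calc dist x y = ‖(x - t • y) + (t • y - y)‖ := by rw [dist_eq_norm]; congr 1; abel
      _ ≤ D + (1 - t) := h1 ▸ norm_add_le _ _
      _ ≤ 2 * D := by linarith
  calc _ ≤ ENNReal.ofReal (F * D ^ (-β) * (L ^ p * (1 - t) ^ (p - γ))) := by
        refine ENNReal.ofReal_le_ofReal ?_
        have h1 : |1 - t ^ a| ^ p ≤ L ^ p * (1 - t) ^ p := by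
          rw [← Real.mul_rpow hL hτ.le]
          exact Real.rpow_le_rpow (abs_nonneg _) hta hp.le
        have h2 : D ^ (-γ) ≤ (1 - t) ^ (-γ) :=
          Real.rpow_le_rpow_of_nonpos hτ hDτ (by linarith)
        rw [div_eq_mul_inv, ← Real.rpow_neg hD0.le, neg_add, Real.rpow_add hD0,
          sub_eq_add_neg p, Real.rpow_add hτ]
        calc _ ≤ (L ^ p * (1 - t) ^ p) * F * (D ^ (-β) * (1 - t) ^ (-γ)) := by gcongr
          _ = _ := by ring
    _ = ENNReal.ofReal F * ENNReal.ofReal (D ^ (-β)) *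
          ENNReal.ofReal (L ^ p * (1 - t) ^ (p - γ)) := by
        rw [ENNReal.ofReal_mul (by positivity), ENNReal.ofReal_mul hF]
    _ ≤ _ := by
        gcongr
        exact ofReal_rpow_neg_norm_le_dyadicKernel hβ hD0 hD2 hxy

end DyadicKernel

lemma exists_abs_one_sub_rpow_le (a : ℝ) :
    ∃ L : ℝ, 0 ≤ L ∧ ∀ t ∈ Set.Icc (1 / 2 : ℝ) 1, |1 - t ^ a| ≤ L * (1 - t) := by
  have hpos : ∀ t ∈ Set.Icc (1 / 2 : ℝ) 1, t ≠ 0 := fun t ht => by linarith [ht.1]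
  obtain ⟨L, hL⟩ := isCompact_Icc.exists_bound_of_continuousOn
    (s := Set.Icc (1 / 2 : ℝ) 1) (f := fun t : ℝ => a * t ^ (a - 1))
    (continuousOn_const.mul (continuousOn_id.rpow_const fun t ht => Or.inl (hpos t ht)))
  have h1 : (1 : ℝ) ∈ Set.Icc (1 / 2 : ℝ) 1 := by norm_num
  refine ⟨L, (norm_nonneg _).trans (hL 1 h1), fun t ht => ?_⟩
  have := Convex.norm_image_sub_le_of_norm_hasDerivWithin_le (f := fun t : ℝ => t ^ a)
    (fun t ht => (Real.hasDerivAt_rpow_const (Or.inl (hpos t ht))).hasDerivWithinAt) hL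
    (convex_Icc _ _) ht h1
  simpa [Real.norm_eq_abs, abs_of_nonneg (sub_nonneg.2 ht.2)] using this

lemma lintegral_one_sub_rpow_ne_top (c : ℝ) {r : ℝ} (hr : -1 < r) :
    ∫⁻ t in Set.Icc (1 / 2 : ℝ) 1, ENNReal.ofReal (c * (1 - t) ^ r) ≠ ∞ := by
  have h := ((intervalIntegral.intervalIntegrable_rpow' (a := 0) (b := 1 / 2) hr).comp_sub_left
    1).const_mul c
  have h2 : IntegrableOn (fun t : ℝ => c * (1 - t) ^ r) (Set.Icc (1 / 2 : ℝ) 1) := by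
    rw [integrableOn_Icc_iff_integrableOn_Ioc]
    have h3 := h.symm.1
    norm_num at h3 ⊢
    exact h3
  exact h2.lintegral_lt_top.ne

lemma isFiniteMeasure_hausdorffMeasure_restrict_sphere (n : ℕ) :
    IsFiniteMeasure ((μH[(n : ℝ) - 1] : Measure (EuclideanSpace ℝ (Fin n))).restrict
      (sphere 0 1)) := by
  obtain ⟨C, hC, hball⟩ := exists_hausdorffMeasure_sphere_inter_closedBall_le n
  have h := hball 0 1 zero_le_one
  rw [Set.inter_eq_left.2 sphere_subset_closedBall] at h
  exact ⟨by rw [Measure.restrict_apply_univ]; exact h.trans_lt (by finiteness)⟩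

lemma lintegral_lintegral_mul_kernel_le {X : Type*} [MeasurableSpace X] {μ : Measure X}
    [SFinite μ] {F : X → ℝ≥0∞} {G : X → X → ℝ≥0∞} (hF : Measurable F)
    (hG : Measurable fun q : X × X => G q.1 q.2) {N : ℝ≥0∞} (hN : ∀ y, ∫⁻ x, G x y ∂μ ≤ N)
    (M : ℝ≥0∞) :
    ∫⁻ x, ∫⁻ y, F y * G x y * M ∂μ ∂μ ≤ M * N * ∫⁻ y, F y ∂μ := by
  calc _ = ∫⁻ y, ∫⁻ x, F y * G x y * M ∂μ ∂μ := by
        refine lintegral_lintegral_swap (Measurable.aemeasurable ?_)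
        exact ((hF.comp measurable_snd).mul hG).mul_const M
    _ ≤ ∫⁻ y, M * N * F y ∂μ := by
        refine lintegral_mono fun y => ?_
        have hGm : Measurable fun x => G x y := hG.comp measurable_prodMk_right
        rw [lintegral_mul_const _ (hGm.const_mul _), lintegral_const_mul _ hGm]
        calc _ ≤ F y * N * M := by gcongr; exact hN y
          _ = _ := by ring
    _ = _ := lintegral_const_mul _ hF

/-- estimate `I₃ ≤ C ‖f‖_{L^p(∂B)}^p` for the contribution of
`t ∈ (1/2, 1)` with kernel `|1-t^a|^p |f(y)|^p / |x - t y|^{n+sp}`. -/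
theorem kernel_integral_I3_estimate
    (n : ℕ) (hn : 2 ≤ n) (a s p : ℝ) (hs0 : 0 < s) (hs1 : s < 1) (hp : 1 ≤ p) :
    ∃ C : ℝ, 0 < C ∧
      ∀ f : EuclideanSpace ℝ (Fin n) → ℝ, Measurable f →
        (∫⁻ x in sphere (0 : EuclideanSpace ℝ (Fin n)) 1,
          ∫⁻ y in sphere (0 : EuclideanSpace ℝ (Fin n)) 1,
            (∫⁻ t in Set.Icc (1 / 2 : ℝ) 1,
              ENNReal.ofReal
                (|1 - t ^ a| ^ p * |f y| ^ p / ‖x - t • y‖ ^ ((n : ℝ) + s * p)))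
          ∂μH[(n : ℝ) - 1] ∂μH[(n : ℝ) - 1])
        ≤ ENNReal.ofReal C *
            ∫⁻ x in sphere (0 : EuclideanSpace ℝ (Fin n)) 1,
              ENNReal.ofReal (|f x| ^ p) ∂μH[(n : ℝ) - 1] := by
  have hn2 : (2 : ℝ) ≤ n := by exact_mod_cast hn
  obtain ⟨ε, hε0, hε⟩ := exists_between
    (lt_min one_pos (mul_pos (one_pos.trans_le hp) (sub_pos.2 hs1)))
  obtain ⟨hε1, hεp⟩ := lt_min_iff.1 hε
  set β : ℝ := n - 1 - ε with hβ
  set γ : ℝ := 1 + s * p + ε with hγ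
  obtain ⟨L, hL0, hL⟩ := exists_abs_one_sub_rpow_le a
  obtain ⟨N, hN, hGN⟩ := exists_lintegral_dyadicKernel_le (n := n) (β := β) (by omega)
    (by linarith)
  set M := ∫⁻ t in Set.Icc (1 / 2 : ℝ) 1, ENNReal.ofReal (L ^ p * (1 - t) ^ (p - γ)) with hMdef
  have hM : M ≠ ∞ := lintegral_one_sub_rpow_ne_top _ (by rw [hγ]; nlinarith)
  have := isFiniteMeasure_hausdorffMeasure_restrict_sphere n
  have hsph : ∀ᵐ x ∂(μH[(n : ℝ) - 1] : Measure (EuclideanSpace ℝ (Fin n))).restrict (sphere 0 1),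
      ‖x‖ = 1 := by
    filter_upwards [ae_restrict_mem isClosed_sphere.measurableSet] with x hx
    exact mem_sphere_zero_iff_norm.1 hx
  have hexp : (n : ℝ) + s * p = β + γ := by rw [hβ, hγ]; ring
  have hβ0 : 0 ≤ β := by linarith
  have hγ0 : 0 ≤ γ := by positivity
  have hp0 : 0 < p := by linarith
  refine ⟨(M * N).toReal + 1, by positivity, fun f hf => ?_⟩
  have hMN : M * N ≤ ENNReal.ofReal ((M * N).toReal + 1) := by
    rw [ENNReal.le_ofReal_iff_toReal_le (by finiteness) (by positivity)]
    linarith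
  refine le_trans ?_ ((lintegral_lintegral_mul_kernel_le (F := fun y => ENNReal.ofReal (|f y| ^ p))
    (by fun_prop) (measurable_dyadicKernel β) hGN M).trans (mul_le_mul_left hMN _))
  refine lintegral_mono_ae ?_
  filter_upwards [hsph] with x hx
  refine lintegral_mono_ae ?_
  filter_upwards [hsph] with y hy
  rw [hMdef, ← lintegral_const_mul _ (by fun_prop), hexp]
  refine setLIntegral_mono' measurableSet_Icc fun t ht => ?_
  exact kernel_le_dyadicKernel hp0 hβ0 hγ0 hL0 (by positivity) ht (hL t ht) hx hy
end

section
/- Let $0 < s < 1$, $1 \le p < \infty$ and $n \ge 2$. Then there exists a constant $C > 0$, depending only on $s, p, n$, such that for all $\tau \in [0, 1/2]$ and all $\theta \in [0, \pi]$ one has $\frac{\tau^p \, \sin^{n-1}\theta}{(\tau^2 + 4(1-\tau)\sin^2(\theta/2))^{(n+sp)/2}} \le C\, (\tau + \sin(\theta/2))^{p - sp - 1} \cos(\theta/2)$. -/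
open Real

/-- If `0 ≤ τ, a ≤ x` and `x² / 2 ≤ D`, the kernel `τ^p (2 a c)^m / D^e` with `m ≥ 1` is bounded by a
multiple of `x^(p + m - 2 e) c`. -/
theorem rpow_mul_two_mul_rpow_div_rpow_le {τ a c x D p m e : ℝ} (hτ : 0 ≤ τ) (hτx : τ ≤ x)
    (ha : 0 ≤ a) (hax : a ≤ x) (hc0 : 0 ≤ c) (hc1 : c ≤ 1) (hx : 0 < x) (hD : x ^ 2 / 2 ≤ D)
    (hp : 0 ≤ p) (hm : 1 ≤ m) (he : 0 ≤ e) :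
    τ ^ p * (2 * a * c) ^ m / D ^ e ≤ 2 ^ (m + e) * x ^ (p + m - 2 * e) * c := by
  have hcm : c ^ m ≤ c := by
    simpa using rpow_le_rpow_of_exponent_ge_of_imp hc0 hc1 hm (fun _ h => by linarith)
  have hxe : (x ^ 2 / 2) ^ e = x ^ (2 * e) / 2 ^ e := by
    rw [div_rpow (by positivity) (by norm_num), rpow_mul hx.le, rpow_two]
  calc τ ^ p * (2 * a * c) ^ m / D ^ e
      ≤ x ^ p * (2 * x * c) ^ m / (x ^ 2 / 2) ^ e := by gcongr
    _ = 2 ^ (m + e) * x ^ (p + m - 2 * e) * c ^ m := by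
        rw [hxe, mul_rpow (by positivity) hc0, mul_rpow (by norm_num) hx.le, rpow_sub hx,
          rpow_add hx, rpow_add two_pos]
        field_simp
    _ ≤ 2 ^ (m + e) * x ^ (p + m - 2 * e) * c := by gcongr

/-- the elementary pointwise estimate
`τ^p sin^{n-1}θ / (τ² + 4(1-τ)sin²(θ/2))^{(n+sp)/2} ≤ C (τ + sin(θ/2))^{p-sp-1} cos(θ/2)`
for `τ ∈ [0,1/2]` and `θ ∈ [0,π]`. -/
theorem pointwise_kernel_estimate_spherical
    (n : ℕ) (hn : 2 ≤ n) (s p : ℝ) (hs0 : 0 < s) (hs1 : s < 1) (hp : 1 ≤ p) :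
    ∃ C : ℝ, 0 < C ∧
      ∀ τ θ : ℝ, τ ∈ Set.Icc (0 : ℝ) (1 / 2) → θ ∈ Set.Icc (0 : ℝ) π →
        τ ^ p * Real.sin θ ^ ((n : ℝ) - 1) /
            (τ ^ 2 + 4 * (1 - τ) * Real.sin (θ / 2) ^ 2) ^ (((n : ℝ) + s * p) / 2)
          ≤ C * (τ + Real.sin (θ / 2)) ^ (p - s * p - 1) * Real.cos (θ / 2) := by
  have hn' : (2 : ℝ) ≤ n := by exact_mod_cast hn
  have hsp : 0 < s * p := by positivity
  refine ⟨2 ^ ((n : ℝ) - 1 + ((n : ℝ) + s * p) / 2), by positivity, ?_⟩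
  rintro τ θ ⟨hτ0, hτ1⟩ ⟨hθ0, hθ1⟩
  have ha : 0 ≤ sin (θ / 2) := sin_nonneg_of_nonneg_of_le_pi (by linarith) (by linarith)
  have hc : 0 ≤ cos (θ / 2) := cos_nonneg_of_neg_pi_div_two_le_of_le (by linarith) (by linarith)
  rcases hτ0.eq_or_lt with rfl | hτ
  · rw [zero_rpow (by linarith), zero_mul, zero_div]
    positivity
  have hsin : sin θ = 2 * sin (θ / 2) * cos (θ / 2) := by
    rw [← sin_two_mul, mul_div_cancel₀ θ two_ne_zero]
  have hD : (τ + sin (θ / 2)) ^ 2 / 2 ≤ τ ^ 2 + 4 * (1 - τ) * sin (θ / 2) ^ 2 := by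
    nlinarith [sq_nonneg (τ - sin (θ / 2)),
      mul_nonneg (sub_nonneg.2 hτ1) (sq_nonneg (sin (θ / 2))), sq_nonneg (sin (θ / 2))]
  rw [hsin, show p - s * p - 1 = p + ((n : ℝ) - 1) - 2 * (((n : ℝ) + s * p) / 2) by ring]
  exact rpow_mul_two_mul_rpow_div_rpow_le hτ.le (by linarith) ha (by linarith) hc (cos_le_one _)
    (by linarith) hD (by linarith) (by linarith) (by positivity)
end

section
/- Let $n \ge 2$ and define $\Phi : \mathbb{R}^n \to \mathbb{R}^n$ by $\Phi(X) := \frac{|X|}{\|X\|_\infty} X$ for $X \ne 0$ and $\Phi(0) := 0$, where $|\ |$ is the Euclidean norm and $\|\ \|_\infty$ is the sup norm on $\mathbb{R}^n$. Then the restriction $\Lambda$ of $\Phi$ to the closed Euclidean unit ball $\overline{B}$ is a bi-Lipschitz homeomorphism from $\overline{B}$ onto the closed cube $\overline{Q} = [-1,1]^n$, and the restriction $\Psi$ of $\Phi$ to the unit sphere $\partial B$ is a bi-Lipschitz homeomorphism from $\partial B$ onto the boundary $\partial Q$ of the cube; i.e., each of these maps is a bijection onto its stated target, is Lipschitz, and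 has a Lipschitz inverse. -/
open scoped Classical

open Metric

/-- The radial map `x ↦ (p x / q x) • x`, which carries the `p`-unit ball to the `q`-unit ball. -/
noncomputable def radialMap {E : Type*} [AddCommGroup E] [Module ℝ E] (p q : Seminorm ℝ E)
    (x : E) : E :=
  (p x / q x) • x

theorem Seminorm.pos_of_forall_norm_le {E : Type*} [NormedAddCommGroup E] [NormedSpace ℝ E]
    {q : Seminorm ℝ E} {b : ℝ} (hq : ∀ x, ‖x‖ ≤ b * q x) {x : E} (hx : x ≠ 0) : 0 < q x := by
  refine lt_of_le_of_ne (apply_nonneg q x) fun h => ?_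
  have := hq x
  rw [← h, mul_zero] at this
  exact hx (norm_le_zero_iff.1 this)

theorem apply_radialMap {E : Type*} [AddCommGroup E] [Module ℝ E] (p q r : Seminorm ℝ E) (x : E) :
    r (radialMap p q x) = p x / q x * r x := by
  rw [radialMap, map_smul_eq_mul, Real.norm_of_nonneg
    (div_nonneg (apply_nonneg p x) (apply_nonneg q x))]

theorem apply_radialMap_self {E : Type*} [NormedAddCommGroup E] [NormedSpace ℝ E]
    (p : Seminorm ℝ E) {q : Seminorm ℝ E} {b : ℝ} (hq : ∀ x, ‖x‖ ≤ b * q x) (x : E) :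
    q (radialMap p q x) = p x := by
  rw [apply_radialMap]
  rcases eq_or_ne x 0 with rfl | hx
  · simp
  · exact div_mul_cancel₀ _ (Seminorm.pos_of_forall_norm_le hq hx).ne'

theorem radialMap_radialMap {E : Type*} [NormedAddCommGroup E] [NormedSpace ℝ E]
    {p q : Seminorm ℝ E} {b c : ℝ} (hp : ∀ x, ‖x‖ ≤ c * p x) (hq : ∀ x, ‖x‖ ≤ b * q x) (x : E) :
    radialMap q p (radialMap p q x) = x := by
  rcases eq_or_ne x 0 with rfl | hx
  · simp [radialMap]
  · have hpx := Seminorm.pos_of_forall_norm_le hp hx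
    have hqx := Seminorm.pos_of_forall_norm_le hq hx
    rw [radialMap, apply_radialMap_self p hq, apply_radialMap, radialMap, smul_smul]
    convert one_smul ℝ x
    field_simp

theorem exists_lipschitzWith_radialMap {E : Type*} [NormedAddCommGroup E] [NormedSpace ℝ E]
    {p q : Seminorm ℝ E} {a b c : ℝ} (ha : 0 ≤ a) (hb : 0 ≤ b) (hc : 0 ≤ c)
    (hpa : ∀ x, p x ≤ a * ‖x‖) (hqb : ∀ x, ‖x‖ ≤ b * q x) (hqc : ∀ x, q x ≤ c * ‖x‖) :
    ∃ K : NNReal, LipschitzWith K (radialMap p q) := by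
  have hratio : ∀ x, p x / q x ≤ a * b := fun x => by
    refine div_le_of_le_mul₀ (apply_nonneg q x) (by positivity) ((hpa x).trans ?_)
    rw [mul_assoc]
    exact mul_le_mul_of_nonneg_left (hqb x) ha
  have hratio0 : ∀ x, 0 ≤ p x / q x := fun x => div_nonneg (apply_nonneg p x) (apply_nonneg q x)
  refine ⟨NNReal.mk (a * b + (a * b * c + a) * b) (by positivity),
    LipschitzWith.of_dist_le_mul fun x y => ?_⟩
  rw [dist_eq_norm, dist_eq_norm, NNReal.coe_mk]
  have hd := norm_nonneg (x - y)
  have hK : 0 ≤ (a * b * c + a) * b * ‖x - y‖ := by positivity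
  rcases eq_or_ne x 0 with rfl | hx
  · have h : ‖radialMap p q y‖ ≤ a * b * ‖y‖ := by
      rw [radialMap, norm_smul, Real.norm_of_nonneg (hratio0 y)]
      exact mul_le_mul_of_nonneg_right (hratio y) (norm_nonneg y)
    have h0 : radialMap p q 0 = 0 := by simp [radialMap]
    rw [h0]
    simp only [zero_sub, norm_neg] at hK ⊢
    linarith
  have hqx := Seminorm.pos_of_forall_norm_le hqb hx
  have hsplit : radialMap p q x - radialMap p q y
      = (p x / q x) • (x - y) + (p x / q x - p y / q y) • y := by
    simp only [radialMap]
    module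
  have hfst : ‖(p x / q x) • (x - y)‖ ≤ a * b * ‖x - y‖ := by
    rw [norm_smul, Real.norm_of_nonneg (hratio0 x)]
    exact mul_le_mul_of_nonneg_right (hratio x) hd
  have hsnd : ‖(p x / q x - p y / q y) • y‖ ≤ (a * b * c + a) * b * ‖x - y‖ := by
    rcases eq_or_ne y 0 with rfl | hy
    · simpa using hK
    have hqy := Seminorm.pos_of_forall_norm_le hqb hy
    have hdiff : (p x / q x - p y / q y) * q y = p x / q x * (q y - q x) + (p x - p y) := by
      field_simp
      ring
    have hq_sub : |q y - q x| ≤ c * ‖x - y‖ := by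
      rw [abs_sub_comm]
      exact (abs_sub_map_le_sub q x y).trans (hqc _)
    have hp_sub : |p x - p y| ≤ a * ‖x - y‖ := (abs_sub_map_le_sub p x y).trans (hpa _)
    have hbound : |p x / q x - p y / q y| * q y ≤ (a * b * c + a) * ‖x - y‖ := by
      calc |p x / q x - p y / q y| * q y = |p x / q x * (q y - q x) + (p x - p y)| := by
            rw [← hdiff, abs_mul, abs_of_pos hqy]
        _ ≤ p x / q x * |q y - q x| + |p x - p y| := by
            refine (abs_add_le _ _).trans_eq ?_
            rw [abs_mul, abs_of_nonneg (hratio0 x)]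
        _ ≤ a * b * (c * ‖x - y‖) + a * ‖x - y‖ :=
            add_le_add (mul_le_mul (hratio x) hq_sub (abs_nonneg _) (by positivity)) hp_sub
        _ = (a * b * c + a) * ‖x - y‖ := by ring
    rw [norm_smul, Real.norm_eq_abs]
    calc |p x / q x - p y / q y| * ‖y‖ ≤ |p x / q x - p y / q y| * (b * q y) :=
          mul_le_mul_of_nonneg_left (hqb y) (abs_nonneg _)
      _ = |p x / q x - p y / q y| * q y * b := by ring
      _ ≤ (a * b * c + a) * ‖x - y‖ * b := mul_le_mul_of_nonneg_right hbound hb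
      _ = _ := by ring
  rw [hsplit]
  linarith [norm_add_le ((p x / q x) • (x - y)) ((p x / q x - p y / q y) • y)]

/-- The sup norm as a seminorm on Euclidean space. -/
noncomputable def euclideanSupSeminorm (ι : Type*) [Fintype ι] :
    Seminorm ℝ (EuclideanSpace ℝ ι) :=
  (normSeminorm ℝ (ι → ℝ)).comp (EuclideanSpace.equiv ι ℝ).toLinearEquiv.toLinearMap

theorem euclideanSupSeminorm_apply {ι : Type*} [Fintype ι] (x : EuclideanSpace ℝ ι) :
    euclideanSupSeminorm ι x = ‖EuclideanSpace.equiv ι ℝ x‖ := rfl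

theorem frontier_setOf_forall_mem_Ioo {ι : Type*} [Fintype ι] :
    frontier {x : EuclideanSpace ℝ ι | ∀ i, x i ∈ Set.Ioo (-1 : ℝ) 1}
      = {x | euclideanSupSeminorm ι x = 1} := by
  have hpre : {x : EuclideanSpace ℝ ι | ∀ i, x i ∈ Set.Ioo (-1 : ℝ) 1}
      = (EuclideanSpace.equiv ι ℝ).toHomeomorph ⁻¹' ball 0 1 := by
    ext x
    simp [pi_norm_lt_iff, abs_lt]
  rw [hpre, ← Homeomorph.preimage_frontier, frontier_ball _ one_ne_zero]
  ext x
  simp [euclideanSupSeminorm_apply]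

theorem setOf_forall_mem_Icc {ι : Type*} [Fintype ι] :
    {x : EuclideanSpace ℝ ι | ∀ i, x i ∈ Set.Icc (-1 : ℝ) 1}
      = {x | euclideanSupSeminorm ι x ≤ 1} := by
  ext x
  simp [euclideanSupSeminorm_apply, pi_norm_le_iff_of_nonneg, abs_le]

/-- the map `Φ(X) = (|X|/‖X‖_∞) X` (with `Φ(0)=0`) restricts to a
bi-Lipschitz homeomorphism from the closed Euclidean unit ball onto the closed cube
`[-1,1]^n`, and from the Euclidean unit sphere onto the boundary of the cube. -/
theorem radial_map_biLipschitz
    (n : ℕ) (hn : 2 ≤ n)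
    (Φ : EuclideanSpace ℝ (Fin n) → EuclideanSpace ℝ (Fin n))
    (hΦ : ∀ X, Φ X = if X = 0 then 0
      else (‖X‖ / ‖WithLp.equiv 2 (Fin n → ℝ) X‖) • X)
    (Q : Set (EuclideanSpace ℝ (Fin n)))
    (hQ : Q = {X : EuclideanSpace ℝ (Fin n) | ∀ i, X i ∈ Set.Ioo (-1 : ℝ) 1}) :
    (Set.BijOn Φ (closedBall (0 : EuclideanSpace ℝ (Fin n)) 1)
        {X : EuclideanSpace ℝ (Fin n) | ∀ i, X i ∈ Set.Icc (-1 : ℝ) 1} ∧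
      (∃ K : NNReal, LipschitzOnWith K Φ (closedBall (0 : EuclideanSpace ℝ (Fin n)) 1)) ∧
      ∃ g : EuclideanSpace ℝ (Fin n) → EuclideanSpace ℝ (Fin n),
        (∃ K' : NNReal, LipschitzOnWith K' g
          {X : EuclideanSpace ℝ (Fin n) | ∀ i, X i ∈ Set.Icc (-1 : ℝ) 1}) ∧
        (∀ X ∈ closedBall (0 : EuclideanSpace ℝ (Fin n)) 1, g (Φ X) = X)) ∧
    (Set.BijOn Φ (sphere (0 : EuclideanSpace ℝ (Fin n)) 1) (frontier Q) ∧
      (∃ K : NNReal, LipschitzOnWith K Φ (sphere (0 : EuclideanSpace ℝ (Fin n)) 1)) ∧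
      ∃ g : EuclideanSpace ℝ (Fin n) → EuclideanSpace ℝ (Fin n),
        (∃ K' : NNReal, LipschitzOnWith K' g (frontier Q)) ∧
        (∀ X ∈ sphere (0 : EuclideanSpace ℝ (Fin n)) 1, g (Φ X) = X)) := by
  set p : Seminorm ℝ (EuclideanSpace ℝ (Fin n)) := normSeminorm ℝ _
  set q := euclideanSupSeminorm (Fin n)
  obtain rfl : Φ = radialMap p q := by
    funext X
    rw [hΦ]
    split_ifs with hX
    · simp [hX, radialMap]
    · rfl
  have hp : ∀ x, ‖x‖ ≤ 1 * p x := fun x => (one_mul ‖x‖).ge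
  have hp' : ∀ x, p x ≤ 1 * ‖x‖ := fun x => (one_mul ‖x‖).ge
  let e := EuclideanSpace.equiv (Fin n) ℝ
  have hq' : ∀ x, q x ≤ ‖(e : EuclideanSpace ℝ (Fin n) →L[ℝ] Fin n → ℝ)‖ * ‖x‖ := fun x =>
    (e : EuclideanSpace ℝ (Fin n) →L[ℝ] Fin n → ℝ).le_opNorm x
  have hq : ∀ x, ‖x‖ ≤ ‖(e.symm : (Fin n → ℝ) →L[ℝ] EuclideanSpace ℝ (Fin n))‖ * q x := fun x =>
    (e.symm : (Fin n → ℝ) →L[ℝ] EuclideanSpace ℝ (Fin n)).le_opNorm (e x)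
  obtain ⟨K, hK⟩ := exists_lipschitzWith_radialMap zero_le_one (norm_nonneg _) (norm_nonneg _)
    hp' hq hq'
  obtain ⟨K', hK'⟩ := exists_lipschitzWith_radialMap (norm_nonneg _) zero_le_one zero_le_one
    hq' hp hp'
  have hpq : Function.LeftInverse (radialMap q p) (radialMap p q) := radialMap_radialMap hp hq
  have hqp : Function.RightInverse (radialMap q p) (radialMap p q) := radialMap_radialMap hq hp
  have hball : closedBall (0 : EuclideanSpace ℝ (Fin n)) 1 = {x | p x ≤ 1} := by
    ext x
    exact mem_closedBall_zero_iff
  have hsphere : sphere (0 : EuclideanSpace ℝ (Fin n)) 1 = {x | p x = 1} := by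
    ext x
    exact mem_sphere_zero_iff_norm
  rw [hQ, frontier_setOf_forall_mem_Ioo, setOf_forall_mem_Icc, hball, hsphere]
  refine ⟨⟨Set.InvOn.bijOn ⟨hpq.leftInvOn _, hqp.leftInvOn _⟩ (fun x hx => ?_) fun x hx => ?_,
      ⟨K, hK.lipschitzOnWith⟩, radialMap q p, ⟨K', hK'.lipschitzOnWith⟩, fun x _ => hpq x⟩,
    Set.InvOn.bijOn ⟨hpq.leftInvOn _, hqp.leftInvOn _⟩ (fun x hx => ?_) fun x hx => ?_,
      ⟨K, hK.lipschitzOnWith⟩, radialMap q p, ⟨K', hK'.lipschitzOnWith⟩, fun x _ => hpq x⟩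
  · exact (apply_radialMap_self p hq x).trans_le hx
  · exact (apply_radialMap_self q hp x).trans_le hx
  · exact (apply_radialMap_self p hq x).trans hx
  · exact (apply_radialMap_self q hp x).trans hx
end

section
/- Let $0 < s < 1$, $1 \le p < \infty$ and $n \ge 2$ be such that $sp < n$. Let $Q := (-1,1)^n$ and, for $f : \partial Q \to \mathbb{R}$, define $Tf(X) := f(X/\|X\|_\infty)$ for $X \in \overline{Q} \setminus \{0\}$. Then there exists a constant $C > 0$, depending only on $s, p, n$, such that for every measurable $f : \partial Q \to \mathbb{R}$ one has $\int_Q |Tf|^p\, dX + \int_Q \int_Q \frac{|Tf(X) - Tf(Y)|^p}{|X - Y|^{n+sp}}\, dX\, dY \le C \left( \int_{\partial Q} |f|^p \, d\mu + \int_{\partial Q}\int_{\partial Q} \frac{|f(x)-f(y)|^p}{|x-y|^{n-1+sp}}\, d\mu(x)\, d\mu(y) \right)$, where both sides are interpreted as values in $[0,\infty]$. -/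
open MeasureTheory Metric

noncomputable section

open Set

/-- The parametrization of the face `{X | X i = ε}` of the cube. -/
def cubeFace {m : ℕ} (k : Fin (m + 1) × ℤˣ) (y : Fin m → ℝ) : EuclideanSpace ℝ (Fin (m + 1)) :=
  WithLp.toLp 2 (k.1.insertNth ((k.2 : ℤ) : ℝ) y)

/-- The open cone over the face `{X | X i = ε}` of the cube. -/
def cubeCone {m : ℕ} (k : Fin (m + 1) × ℤˣ) : Set (EuclideanSpace ℝ (Fin (m + 1))) :=
  {X | ((k.2 : ℤ) : ℝ) * X k.1 ∈ Ioo (0 : ℝ) 1 ∧ ∀ j, |X j| ≤ ((k.2 : ℤ) : ℝ) * X k.1}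

/-- The surface measure of the cube, as the sum of the Lebesgue measures of its faces. -/
def cubeSurface (m : ℕ) : Measure (EuclideanSpace ℝ (Fin (m + 1))) :=
  Measure.sum fun k : Fin (m + 1) × ℤˣ =>
    ((volume : Measure (Fin m → ℝ)).restrict (closedBall 0 1)).map (cubeFace k)

instance (m : ℕ) : SFinite (cubeSurface m) := by
  unfold cubeSurface; infer_instance

lemma units_mul_self_real (ε : ℤˣ) : ((ε : ℤ) : ℝ) * ((ε : ℤ) : ℝ) = 1 := by
  rcases Int.units_eq_one_or ε with h | h <;> simp [h]

lemma abs_units_real (ε : ℤˣ) : |((ε : ℤ) : ℝ)| = 1 := by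
  rcases Int.units_eq_one_or ε with h | h <;> simp [h]

lemma continuous_toLp_insertNth {m : ℕ} (i : Fin (m + 1)) :
    Continuous fun q : ℝ × (Fin m → ℝ) =>
      (WithLp.toLp 2 (i.insertNth q.1 q.2 : Fin (m + 1) → ℝ) :
        EuclideanSpace ℝ (Fin (m + 1))) :=
  (PiLp.continuous_toLp 2 _).comp
    (Continuous.finInsertNth (A := fun _ => ℝ) i continuous_fst continuous_snd)

lemma continuous_cubeFace {m : ℕ} (k : Fin (m + 1) × ℤˣ) : Continuous (cubeFace k) :=
  (continuous_toLp_insertNth k.1).comp (Continuous.prodMk continuous_const continuous_id)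

lemma smul_cubeFace {m : ℕ} (k : Fin (m + 1) × ℤˣ) (t : ℝ) (y : Fin m → ℝ) :
    t • cubeFace k y = WithLp.toLp 2 (k.1.insertNth (((k.2 : ℤ) : ℝ) * t) (t • y)) := by
  ext j
  rcases Fin.eq_self_or_eq_succAbove k.1 j with h | ⟨l, h⟩
  · subst h; simp [cubeFace, mul_comm]
  · subst h; simp [cubeFace]

lemma smul_cubeFace_mem_cubeCone_iff {m : ℕ} (k : Fin (m + 1) × ℤˣ) {t : ℝ} (y : Fin m → ℝ) :
    t • cubeFace k y ∈ cubeCone k ↔ t ∈ Ioo (0 : ℝ) 1 ∧ y ∈ closedBall (0 : Fin m → ℝ) 1 := by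
  have h1 : ((k.2 : ℤ) : ℝ) * (t • cubeFace k y) k.1 = t := by
    have := units_mul_self_real k.2
    simp only [cubeFace, PiLp.smul_apply, Fin.insertNth_apply_same, smul_eq_mul]
    linear_combination t * this
  rw [cubeCone, mem_ofPred_eq, h1]
  refine and_congr_right fun ht => ?_
  rw [mem_closedBall_zero_iff, pi_norm_le_iff_of_nonneg zero_le_one, Fin.forall_iff_succAbove k.1]
  simp only [cubeFace, PiLp.smul_apply, Fin.insertNth_apply_same, smul_eq_mul,
    Fin.insertNth_apply_succAbove, abs_mul, abs_units_real, abs_of_pos ht.1, Real.norm_eq_abs]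
  have := ht.1
  constructor
  · rintro ⟨-, h⟩ j
    have := h j
    nlinarith
  · intro h
    refine ⟨by simp, fun j => ?_⟩
    have := h j
    nlinarith

lemma measurableSet_cubeCone {m : ℕ} (k : Fin (m + 1) × ℤˣ) : MeasurableSet (cubeCone k) := by
  have h : ∀ j, Measurable fun X : EuclideanSpace ℝ (Fin (m + 1)) => X j := fun j => by fun_prop
  refine MeasurableSet.inter (((h k.1).const_mul _) measurableSet_Ioo) ?_
  have : {X : EuclideanSpace ℝ (Fin (m + 1)) | ∀ j, |X j| ≤ ((k.2 : ℤ) : ℝ) * X k.1}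
      = ⋂ j, {X | |X j| ≤ ((k.2 : ℤ) : ℝ) * X k.1} := by ext; simp
  change MeasurableSet {X : EuclideanSpace ℝ (Fin (m + 1)) | ∀ j, |X j| ≤ ((k.2 : ℤ) : ℝ) * X k.1}
  rw [this]
  exact MeasurableSet.iInter fun j => measurableSet_le (h j).abs ((h k.1).const_mul _)

lemma lintegral_comp_smul_pi {m : ℕ} {H : (Fin m → ℝ) → ENNReal} (hH : Measurable H) {t : ℝ}
    (ht : 0 < t) :
    ENNReal.ofReal (t ^ m) * ∫⁻ y, H (t • y) = ∫⁻ z, H z := by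
  rw [← lintegral_map hH (measurable_const_smul t),
    Measure.map_addHaar_smul _ ht.ne', lintegral_smul_measure, smul_eq_mul, ← mul_assoc,
    ← ENNReal.ofReal_mul (by positivity)]
  have : t ^ m * |(t ^ Module.finrank ℝ (Fin m → ℝ))⁻¹| = 1 := by
    rw [Module.finrank_fin_fun, abs_of_pos (by positivity)]
    exact mul_inv_cancel₀ (by positivity)
  rw [this]; simp

lemma setLIntegral_cubeCone {m : ℕ} (k : Fin (m + 1) × ℤˣ)
    {g : EuclideanSpace ℝ (Fin (m + 1)) → ENNReal} (hg : Measurable g) :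
    ∫⁻ X in cubeCone k, g X = ∫⁻ t in Ioo (0 : ℝ) 1, ENNReal.ofReal (t ^ m) *
      ∫⁻ y in closedBall (0 : Fin m → ℝ) 1, g (t • cubeFace k y) := by
  set G := (cubeCone k).indicator g with hG
  have hGm : Measurable G := hg.indicator (measurableSet_cubeCone k)
  have hΨ : MeasurePreserving (fun q : ℝ × (Fin m → ℝ) =>
      (WithLp.toLp 2 (k.1.insertNth q.1 q.2 : Fin (m + 1) → ℝ) :
        EuclideanSpace ℝ (Fin (m + 1)))) :=
    (PiLp.volume_preserving_toLp (Fin (m + 1))).comp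
      (volume_preserving_piFinSuccAbove (fun _ : Fin (m + 1) => ℝ) k.1).symm
  have hε : MeasurePreserving (fun t : ℝ => ((k.2 : ℤ) : ℝ) * t) := by
    rcases Int.units_eq_one_or k.2 with h | h
    · simpa [h, Function.id_def] using MeasurePreserving.id (volume : Measure ℝ)
    · simpa [h] using Measure.measurePreserving_neg (volume : Measure ℝ)
  have hGΨ : Measurable fun q : ℝ × (Fin m → ℝ) =>
      G (WithLp.toLp 2 (k.1.insertNth q.1 q.2)) := hGm.comp hΨ.measurable
  rw [← lintegral_indicator (measurableSet_cubeCone k), ← hG, ← hΨ.lintegral_comp hGm,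
    Measure.volume_eq_prod, lintegral_prod _ hGΨ.aemeasurable,
    ← hε.lintegral_comp hGΨ.lintegral_prod_right', ← lintegral_indicator measurableSet_Ioo]
  refine lintegral_congr fun t => ?_
  by_cases ht : t ∈ Ioo (0 : ℝ) 1
  · rw [indicator_of_mem ht, ← lintegral_indicator measurableSet_closedBall]
    rw [← lintegral_comp_smul_pi (H := fun z => G (WithLp.toLp 2
      (k.1.insertNth (((k.2 : ℤ) : ℝ) * t) z))) (hGΨ.comp measurable_prodMk_left) ht.1]
    congr 1
    refine lintegral_congr fun y => ?_
    rw [← smul_cubeFace]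
    have h := smul_cubeFace_mem_cubeCone_iff k (t := t) y
    by_cases hy : y ∈ closedBall (0 : Fin m → ℝ) 1
    · rw [indicator_of_mem hy, hG, indicator_of_mem (h.2 ⟨ht, hy⟩)]
    · rw [indicator_of_notMem hy, hG, indicator_of_notMem fun h' => hy (h.1 h').2]
  · rw [indicator_of_notMem ht]
    refine (lintegral_congr fun z => ?_).trans lintegral_zero
    refine indicator_of_notMem (fun h => ht ?_) _
    have := h.1
    have h2 := units_mul_self_real k.2
    simp only [Fin.insertNth_apply_same, ← mul_assoc, h2, one_mul] at this
    exact this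

lemma cube_diff_zero_subset {m : ℕ} :
    {X : EuclideanSpace ℝ (Fin (m + 1)) | ∀ i, X i ∈ Ioo (-1 : ℝ) 1} \ {0}
      ⊆ ⋃ k : Fin (m + 1) × ℤˣ, cubeCone k := by
  rintro X ⟨hX, hX0⟩
  obtain ⟨i, hi⟩ := Finite.exists_max fun i => |X i|
  have hpos : 0 < |X i| := by
    by_contra! h
    refine hX0 ?_
    rw [mem_singleton_iff]
    ext j
    simpa using (hi j).trans h
  have hlt : |X i| < 1 := abs_lt.2 (hX i)
  rw [mem_iUnion]
  rcases le_total 0 (X i) with h | h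
  · refine ⟨(i, 1), ?_⟩
    rw [abs_of_nonneg h] at *
    simpa [cubeCone] using ⟨⟨hpos, hlt⟩, hi⟩
  · refine ⟨(i, -1), ?_⟩
    rw [abs_of_nonpos h] at *
    simpa [cubeCone] using ⟨⟨by linarith, by linarith⟩, hi⟩

lemma lintegral_cubeSurface {m : ℕ} {h : EuclideanSpace ℝ (Fin (m + 1)) → ENNReal}
    (hh : Measurable h) :
    ∫⁻ x, h x ∂(cubeSurface m) = ∑ k : Fin (m + 1) × ℤˣ,
      ∫⁻ y in closedBall (0 : Fin m → ℝ) 1, h (cubeFace k y) := by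
  rw [cubeSurface, lintegral_sum_measure, tsum_fintype]
  exact Finset.sum_congr rfl fun k _ => lintegral_map hh (continuous_cubeFace k).measurable

/-- Polar coordinates on the cube. -/
lemma setLIntegral_cube_le {m : ℕ} {g : EuclideanSpace ℝ (Fin (m + 1)) → ENNReal}
    (hg : Measurable g) :
    ∫⁻ X in {X : EuclideanSpace ℝ (Fin (m + 1)) | ∀ i, X i ∈ Ioo (-1 : ℝ) 1}, g X ≤
      ∫⁻ x, (∫⁻ t in Ioo (0 : ℝ) 1, ENNReal.ofReal (t ^ m) * g (t • x)) ∂(cubeSurface m) := by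
  have hjoint : Measurable fun q : EuclideanSpace ℝ (Fin (m + 1)) × ℝ =>
      ENNReal.ofReal (q.2 ^ m) * g (q.2 • q.1) :=
    (by fun_prop : Measurable fun q : EuclideanSpace ℝ (Fin (m + 1)) × ℝ =>
      ENNReal.ofReal (q.2 ^ m)).mul (hg.comp (by fun_prop))
  rw [lintegral_cubeSurface hjoint.lintegral_prod_right',
    ← setLIntegral_congr (sdiff_null_ae_eq_self (measure_singleton (0 : EuclideanSpace ℝ _)))]
  refine (lintegral_mono_set cube_diff_zero_subset).trans
    ((lintegral_iUnion_le _ _).trans_eq ?_)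
  rw [tsum_fintype]
  refine Finset.sum_congr rfl fun k _ => ?_
  rw [setLIntegral_cubeCone k hg, lintegral_lintegral_swap]
  · refine lintegral_congr fun t => ?_
    refine (lintegral_const_mul _ ?_).symm
    exact hg.comp ((continuous_cubeFace k).measurable.const_smul t)
  · exact (hjoint.comp (((continuous_cubeFace k).measurable.comp measurable_fst).prodMk
      measurable_snd)).aemeasurable

lemma cubeFace_mem_frontier {m : ℕ} (k : Fin (m + 1) × ℤˣ) {y : Fin m → ℝ}
    (hy : y ∈ closedBall (0 : Fin m → ℝ) 1) :
    cubeFace k y ∈ frontier {X : EuclideanSpace ℝ (Fin (m + 1)) | ∀ i, X i ∈ Ioo (-1 : ℝ) 1} := by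
  refine ⟨?_, fun h => ?_⟩
  · have hlim : Filter.Tendsto (fun t : ℝ => t • cubeFace k y) (nhdsWithin 1 (Ioo 0 1))
        (nhds (cubeFace k y)) := by
      have : Continuous fun t : ℝ => t • cubeFace k y := by fun_prop
      simpa using (this.tendsto 1).mono_left nhdsWithin_le_nhds
    have : (nhdsWithin (1 : ℝ) (Ioo 0 1)).NeBot := right_nhdsWithin_Ioo_neBot one_pos
    refine mem_closure_of_tendsto hlim ?_
    filter_upwards [self_mem_nhdsWithin] with t ht i
    obtain ⟨h1, h2⟩ := (smul_cubeFace_mem_cubeCone_iff k y).2 ⟨ht, hy⟩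
    exact abs_lt.1 ((h2 i).trans_lt h1.2)
  · have := interior_subset h k.1
    have h2 : |cubeFace k y k.1| < 1 := abs_lt.2 this
    simp [cubeFace, abs_units_real] at h2

lemma norm_cubeFace {m : ℕ} (k : Fin (m + 1) × ℤˣ) {y : Fin m → ℝ}
    (hy : y ∈ closedBall (0 : Fin m → ℝ) 1) :
    ‖WithLp.ofLp (cubeFace k y)‖ = 1 := by
  rw [mem_closedBall_zero_iff, pi_norm_le_iff_of_nonneg zero_le_one] at hy
  refine le_antisymm ?_ ?_
  · rw [pi_norm_le_iff_of_nonneg zero_le_one, Fin.forall_iff_succAbove k.1]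
    simpa [cubeFace, abs_units_real] using hy
  · have := norm_le_pi_norm (WithLp.ofLp (cubeFace k y)) k.1
    simpa [cubeFace, abs_units_real] using this

lemma ae_cubeSurface_norm {m : ℕ} : ∀ᵐ x ∂(cubeSurface m), ‖WithLp.ofLp x‖ = 1 := by
  rw [cubeSurface, Measure.ae_sum_iff]
  intro k
  rw [ae_map_iff (continuous_cubeFace k).aemeasurable
    (measurableSet_eq_fun (by fun_prop) measurable_const)]
  filter_upwards [ae_restrict_mem measurableSet_closedBall] with y hy using norm_cubeFace k hy

lemma map_cubeFace_le {m : ℕ} (k : Fin (m + 1) × ℤˣ) :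
    ((volume : Measure (Fin m → ℝ)).restrict (closedBall 0 1)).map (cubeFace k) ≤
      (Measure.hausdorffMeasure (m : ℝ)).restrict
        (frontier {X : EuclideanSpace ℝ (Fin (m + 1)) | ∀ i, X i ∈ Ioo (-1 : ℝ) 1}) := by
  refine Measure.le_iff.2 fun A hA => ?_
  rw [Measure.map_apply (continuous_cubeFace k).measurable hA,
    Measure.restrict_apply ((continuous_cubeFace k).measurable hA), Measure.restrict_apply hA]
  let π : EuclideanSpace ℝ (Fin (m + 1)) → Fin m → ℝ := fun X j => X (k.1.succAbove j)
  have hπ : LipschitzWith 1 π := LipschitzWith.of_dist_le_mul fun X Y => by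
    rw [NNReal.coe_one, one_mul, dist_pi_le_iff dist_nonneg]
    intro j
    rw [dist_eq_norm, dist_eq_norm]
    exact PiLp.norm_apply_le (X - Y) (k.1.succAbove j)
  have h1 : (volume : Measure (Fin m → ℝ)) = Measure.hausdorffMeasure (m : ℝ) := by
    rw [← hausdorffMeasure_pi_real, Fintype.card_fin]
  rw [h1]
  have h2 := hπ.hausdorffMeasure_image_le (Nat.cast_nonneg m)
    (A ∩ frontier {X : EuclideanSpace ℝ (Fin (m + 1)) | ∀ i, X i ∈ Ioo (-1 : ℝ) 1})
  rw [ENNReal.coe_one, ENNReal.one_rpow, one_mul] at h2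
  refine (measure_mono ?_).trans h2
  rintro y ⟨hyA, hy⟩
  refine ⟨cubeFace k y, ⟨hyA, cubeFace_mem_frontier k hy⟩, ?_⟩
  ext j
  simp [π, cubeFace]

lemma cubeSurface_le (m : ℕ) :
    cubeSurface m ≤ (Fintype.card (Fin (m + 1) × ℤˣ) : ENNReal) •
      (Measure.hausdorffMeasure (m : ℝ)).restrict
        (frontier {X : EuclideanSpace ℝ (Fin (m + 1)) | ∀ i, X i ∈ Ioo (-1 : ℝ) 1}) := by
  refine Measure.le_iff.2 fun A hA => ?_
  rw [cubeSurface, Measure.sum_apply _ hA, tsum_fintype]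
  refine (Finset.sum_le_sum fun k _ => map_cubeFace_le k A).trans ?_
  simp

lemma lintegral_abs_sub_add_rpow_neg (q t : ℝ) {a : ℝ} (ha : 0 < a) :
    ∫⁻ r : ℝ, ENNReal.ofReal ((|t - r| + a) ^ (-q)) =
      ENNReal.ofReal (a ^ (1 - q)) * ∫⁻ v : ℝ, ENNReal.ofReal ((1 + ‖v‖) ^ (-q)) := by
  have hm : Measurable fun u : ℝ => ENNReal.ofReal ((|u| + a) ^ (-q)) := by fun_prop
  rw [lintegral_sub_left_eq_self (fun u => ENNReal.ofReal ((|u| + a) ^ (-q))) t,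
    ← Real.smul_map_volume_mul_left ha.ne', lintegral_smul_measure,
    lintegral_map hm (measurable_const_mul a), Real.smul_map_volume_mul_left ha.ne', smul_eq_mul,
    ← lintegral_const_mul _ (by fun_prop), ← lintegral_const_mul _ (by fun_prop)]
  refine lintegral_congr fun v => ?_
  rw [← ENNReal.ofReal_mul (abs_nonneg a), ← ENNReal.ofReal_mul (by positivity), abs_mul,
    abs_of_pos ha, Real.norm_eq_abs, show a * |v| + a = a * (1 + |v|) by ring,
    Real.mul_rpow ha.le (by positivity), ← mul_assoc, sub_eq_add_neg, Real.rpow_add ha,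
    Real.rpow_one]

lemma norm_ofLp_le {ι : Type*} [Fintype ι] (x : EuclideanSpace ℝ ι) : ‖WithLp.ofLp x‖ ≤ ‖x‖ :=
  (pi_norm_le_iff_of_nonneg (norm_nonneg _)).2 fun i => PiLp.norm_apply_le x i

lemma abs_sub_add_mul_norm_sub_le {ι : Type*} [Fintype ι] {x y : EuclideanSpace ℝ ι} {M t r : ℝ}
    (hx : ‖WithLp.ofLp x‖ = 1) (hy : ‖WithLp.ofLp y‖ = 1) (hM : ‖y‖ ≤ M)
    (ht : 0 ≤ t) (hr : 0 ≤ r) :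
    |t - r| + t * ‖x - y‖ ≤ (2 + M) * ‖t • x - r • y‖ := by
  have h1 : |t - r| ≤ ‖t • x - r • y‖ := by
    refine le_trans ?_ (norm_ofLp_le _)
    have := abs_norm_sub_norm_le (WithLp.ofLp (t • x)) (WithLp.ofLp (r • y))
    rw [WithLp.ofLp_smul, WithLp.ofLp_smul, norm_smul, norm_smul, hx, hy, mul_one, mul_one,
      Real.norm_of_nonneg ht, Real.norm_of_nonneg hr] at this
    simpa using this
  have h2 : t * ‖x - y‖ ≤ ‖t • x - r • y‖ + |t - r| * ‖y‖ := by
    calc t * ‖x - y‖ = ‖(t • x - r • y) - (t - r) • y‖ := by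
          rw [← Real.norm_of_nonneg ht, ← norm_smul, Real.norm_of_nonneg ht]
          congr 1; module
      _ ≤ _ := by
          refine (norm_sub_le _ _).trans ?_
          rw [norm_smul, Real.norm_eq_abs]
  have h3 : |t - r| * ‖y‖ ≤ ‖t • x - r • y‖ * M :=
    mul_le_mul h1 hM (norm_nonneg _) (norm_nonneg _)
  linarith

lemma pow_mul_pow_mul_rpow_neg_le {m : ℕ} {q L d w t r : ℝ} (hq : 0 ≤ q) (hL : 0 ≤ L)
    (hd : 0 < d) (ht : 0 < t) (hr : 0 < r)
    (h1 : |t - r| + t * d ≤ L * w) (hrt : r ≤ t) :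
    t ^ m * r ^ m * w ^ (-q) ≤ L ^ q * (t ^ (2 * m) * (|t - r| + t * d) ^ (-q)) := by
  have hA : 0 < |t - r| + t * d := by positivity
  have hLw : 0 < L * w := hA.trans_le h1
  have hL' : 0 < L := lt_of_le_of_ne hL (by rintro rfl; simp at hLw)
  have hw : 0 < w := pos_of_mul_pos_right hLw hL
  have h2 : w ^ (-q) ≤ L ^ q * (|t - r| + t * d) ^ (-q) := by
    have h3 := Real.rpow_le_rpow_of_nonpos hA h1 (neg_nonpos.2 hq)
    rw [Real.mul_rpow hL hw.le] at h3
    calc w ^ (-q) = L ^ q * (L ^ (-q) * w ^ (-q)) := by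
          rw [← mul_assoc, ← Real.rpow_add hL']; simp
      _ ≤ _ := by gcongr
  have h4 : t ^ m * r ^ m ≤ t ^ (2 * m) := by
    rw [two_mul, pow_add]; gcongr
  calc _ ≤ t ^ (2 * m) * (L ^ q * (|t - r| + t * d) ^ (-q)) := by gcongr
    _ = _ := by ring

/-- The kernel bound obtained by integrating the Gagliardo kernel along pairs of rays. -/
lemma exists_lintegral_kernel_le (m : ℕ) {q : ℝ} (hq1 : 1 < q) (hq2 : q < 2 * m + 2) :
    ∃ C : ENNReal, C ≠ ⊤ ∧ ∀ x y : EuclideanSpace ℝ (Fin (m + 1)),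
      ‖WithLp.ofLp x‖ = 1 → ‖WithLp.ofLp y‖ = 1 → x ≠ y →
      ∫⁻ t in Ioo (0 : ℝ) 1, ∫⁻ r in Ioo (0 : ℝ) 1,
        ENNReal.ofReal (t ^ m * r ^ m * ‖t • x - r • y‖ ^ (-q)) ≤
          C * ENNReal.ofReal (‖x - y‖ ^ (1 - q)) := by
  obtain ⟨M, hM0, hM⟩ : ∃ M : ℝ, 0 ≤ M ∧ ∀ x : EuclideanSpace ℝ (Fin (m + 1)),
      ‖WithLp.ofLp x‖ = 1 → ‖x‖ ≤ M := by
    let e := (EuclideanSpace.equiv (Fin (m + 1)) ℝ).symm.toContinuousLinearMap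
    refine ⟨‖e‖, norm_nonneg _, fun x hx => ?_⟩
    have h : ‖x‖ ≤ ‖e‖ * ‖WithLp.ofLp x‖ := e.le_opNorm (WithLp.ofLp x)
    rwa [hx, mul_one] at h
  set I : ENNReal := ∫⁻ v : ℝ, ENNReal.ofReal ((1 + ‖v‖) ^ (-q)) with hI
  have hIfin : I ≠ ⊤ := (finite_integral_one_add_norm (by simpa using hq1)).ne
  set J : ENNReal := ∫⁻ t in Ioo (0 : ℝ) 1, ENNReal.ofReal (t ^ (2 * m + 1 - q)) with hJ
  have hJfin : J ≠ ⊤ := by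
    have : IntegrableOn (fun t : ℝ => t ^ (2 * m + 1 - q)) (Ioo 0 1) :=
      (intervalIntegral.integrableOn_Ioo_rpow_iff one_pos).2 (by linarith)
    exact this.lintegral_lt_top.ne
  refine ⟨ENNReal.ofReal ((2 + M) ^ q) * (J * I + J * I), by finiteness, fun x y hx hy hxy => ?_⟩
  set d := ‖x - y‖ with hd
  have hd0 : 0 < d := norm_pos_iff.2 (sub_ne_zero.2 hxy)
  let G : ℝ → ℝ → ENNReal := fun t r => ENNReal.ofReal (t ^ (2 * m) * (|t - r| + t * d) ^ (-q))
  have hGm : Measurable fun z : ℝ × ℝ => G z.1 z.2 := by fun_prop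
  have hpt : ∀ t ∈ Ioo (0 : ℝ) 1, ∀ r ∈ Ioo (0 : ℝ) 1,
      ENNReal.ofReal (t ^ m * r ^ m * ‖t • x - r • y‖ ^ (-q)) ≤
        ENNReal.ofReal ((2 + M) ^ q) * (G t r + G r t) := by
    intro t ht r hr
    rcases le_total r t with h | h
    · refine le_trans ?_ (mul_le_mul_right le_self_add _)
      rw [← ENNReal.ofReal_mul (by positivity)]
      exact ENNReal.ofReal_le_ofReal (pow_mul_pow_mul_rpow_neg_le (by linarith) (by positivity)
        hd0 ht.1 hr.1 (abs_sub_add_mul_norm_sub_le hx hy (hM y hy) ht.1.le hr.1.le) h)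
    · refine le_trans ?_ (mul_le_mul_right le_add_self _)
      rw [← ENNReal.ofReal_mul (by positivity), mul_comm (t ^ m), norm_sub_rev]
      refine ENNReal.ofReal_le_ofReal (pow_mul_pow_mul_rpow_neg_le (by linarith) (by positivity)
        hd0 hr.1 ht.1 ?_ h)
      rw [hd, norm_sub_rev x y]
      exact abs_sub_add_mul_norm_sub_le hy hx (hM x hx) hr.1.le ht.1.le
  have hG : ∫⁻ t in Ioo (0 : ℝ) 1, ∫⁻ r in Ioo (0 : ℝ) 1, G t r ≤
      J * I * ENNReal.ofReal (d ^ (1 - q)) := by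
    have : J * I * ENNReal.ofReal (d ^ (1 - q)) = ∫⁻ t in Ioo (0 : ℝ) 1,
        ENNReal.ofReal (t ^ (2 * m + 1 - q)) * (I * ENNReal.ofReal (d ^ (1 - q))) := by
      rw [lintegral_mul_const _ (by fun_prop), mul_assoc]
    rw [this]
    refine setLIntegral_mono' measurableSet_Ioo fun t ht => ?_
    calc ∫⁻ r in Ioo (0 : ℝ) 1, G t r ≤ ∫⁻ r, G t r := setLIntegral_le_lintegral _ _
      _ = ENNReal.ofReal (t ^ (2 * m)) *
          ∫⁻ r, ENNReal.ofReal ((|t - r| + t * d) ^ (-q)) := by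
        rw [← lintegral_const_mul _ (by fun_prop)]
        refine lintegral_congr fun r => ENNReal.ofReal_mul (pow_nonneg ht.1.le _)
      _ = ENNReal.ofReal (t ^ (2 * m + 1 - q)) * (I * ENNReal.ofReal (d ^ (1 - q))) := by
        have ht0 := ht.1
        rw [lintegral_abs_sub_add_rpow_neg q t (mul_pos ht0 hd0), Real.mul_rpow ht0.le hd0.le,
          ENNReal.ofReal_mul (by positivity), add_sub_assoc, Real.rpow_add ht0,
          ENNReal.ofReal_mul (by positivity), ← hI]
        have : t ^ (2 * (m : ℝ)) = t ^ (2 * m) := by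
          rw [← Real.rpow_natCast]; push_cast; rfl
        rw [this]
        ring
  calc _ ≤ ∫⁻ t in Ioo (0 : ℝ) 1, ∫⁻ r in Ioo (0 : ℝ) 1,
        ENNReal.ofReal ((2 + M) ^ q) * (G t r + G r t) :=
        setLIntegral_mono' measurableSet_Ioo fun t ht =>
          setLIntegral_mono' measurableSet_Ioo fun r hr => hpt t ht r hr
    _ = ENNReal.ofReal ((2 + M) ^ q) * ((∫⁻ t in Ioo (0 : ℝ) 1, ∫⁻ r in Ioo (0 : ℝ) 1, G t r) +
          ∫⁻ t in Ioo (0 : ℝ) 1, ∫⁻ r in Ioo (0 : ℝ) 1, G r t) := by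
        rw [← lintegral_add_left hGm.lintegral_prod_right', ← lintegral_const_mul' _ _ (by finiteness)]
        refine lintegral_congr fun t => ?_
        rw [lintegral_const_mul' _ _ (by finiteness)]
        exact congrArg _ (lintegral_add_left (hGm.comp measurable_prodMk_left) _)
    _ ≤ _ := by
        rw [lintegral_lintegral_swap (f := fun t r => G r t)
          (hGm.comp measurable_swap).aemeasurable, mul_assoc, add_mul]
        gcongr

lemma inv_norm_smul_smul_eq {ι : Type*} [Fintype ι] {x : EuclideanSpace ℝ ι}
    (hx : ‖WithLp.ofLp x‖ = 1) {t : ℝ} (ht : 0 < t) :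
    (‖WithLp.ofLp (t • x)‖)⁻¹ • (t • x) = x := by
  rw [WithLp.ofLp_smul, norm_smul, hx, mul_one, Real.norm_of_nonneg ht.le, smul_smul,
    inv_mul_cancel₀ ht.ne', one_smul]

lemma lintegral_cube_radial_le (m : ℕ) {g : EuclideanSpace ℝ (Fin (m + 1)) → ENNReal}
    (hg : Measurable g) :
    ∫⁻ X in {X : EuclideanSpace ℝ (Fin (m + 1)) | ∀ i, X i ∈ Ioo (-1 : ℝ) 1},
      g ((‖WithLp.ofLp X‖)⁻¹ • X) ≤ ∫⁻ x, g x ∂(cubeSurface m) := by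
  refine (setLIntegral_cube_le (hg.comp (by fun_prop))).trans (lintegral_mono_ae ?_)
  filter_upwards [ae_cubeSurface_norm] with x hx
  calc _ ≤ ∫⁻ _ in Ioo (0 : ℝ) 1, g x := by
        refine setLIntegral_mono' measurableSet_Ioo fun t ht => ?_
        rw [Function.comp_apply, inv_norm_smul_smul_eq hx ht.1]
        refine mul_le_of_le_one_left zero_le (ENNReal.ofReal_le_one.2 ?_)
        exact pow_le_one₀ ht.1.le ht.2.le
    _ = g x := by simp

lemma lintegral_cube_radial_gagliardo_le (m : ℕ) {p q : ℝ} (hp : 0 < p) (hq1 : 1 < q)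
    (hq2 : q < 2 * m + 2) :
    ∃ C : ENNReal, C ≠ ⊤ ∧ ∀ f : EuclideanSpace ℝ (Fin (m + 1)) → ℝ, Measurable f →
      ∫⁻ X in {X : EuclideanSpace ℝ (Fin (m + 1)) | ∀ i, X i ∈ Ioo (-1 : ℝ) 1},
        ∫⁻ Y in {X : EuclideanSpace ℝ (Fin (m + 1)) | ∀ i, X i ∈ Ioo (-1 : ℝ) 1},
          ENNReal.ofReal (|f ((‖WithLp.ofLp X‖)⁻¹ • X) - f ((‖WithLp.ofLp Y‖)⁻¹ • Y)| ^ p /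
            ‖X - Y‖ ^ q) ≤
      C * ∫⁻ x, ∫⁻ y, ENNReal.ofReal (|f x - f y| ^ p / ‖x - y‖ ^ (q - 1))
        ∂(cubeSurface m) ∂(cubeSurface m) := by
  obtain ⟨C, hC, hK⟩ := exists_lintegral_kernel_le m hq1 hq2
  refine ⟨C, hC, fun f hf => ?_⟩
  set R : EuclideanSpace ℝ (Fin (m + 1)) → ℝ := fun X => f ((‖WithLp.ofLp X‖)⁻¹ • X) with hR
  have hRm : Measurable R := hf.comp (by fun_prop)
  have hΦ : Measurable fun z : EuclideanSpace ℝ (Fin (m + 1)) × EuclideanSpace ℝ (Fin (m + 1)) =>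
      ENNReal.ofReal (|R z.1 - R z.2| ^ p / ‖z.1 - z.2‖ ^ q) := by fun_prop
  refine (setLIntegral_cube_le hΦ.lintegral_prod_right').trans ?_
  rw [← lintegral_const_mul' _ _ hC]
  refine lintegral_mono_ae ?_
  filter_upwards [ae_cubeSurface_norm] with x hx
  have hker : Measurable fun z : (ℝ × EuclideanSpace ℝ (Fin (m + 1))) × ℝ =>
      ENNReal.ofReal (|f x - f z.1.2| ^ p) *
        ENNReal.ofReal (z.1.1 ^ m * z.2 ^ m * ‖z.1.1 • x - z.2 • z.1.2‖ ^ (-q)) := by fun_prop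
  calc _ ≤ ∫⁻ t in Ioo (0 : ℝ) 1, ∫⁻ y, (∫⁻ r in Ioo (0 : ℝ) 1,
        ENNReal.ofReal (|f x - f y| ^ p) *
          ENNReal.ofReal (t ^ m * r ^ m * ‖t • x - r • y‖ ^ (-q))) ∂(cubeSurface m) := by
        refine setLIntegral_mono' measurableSet_Ioo fun t ht => ?_
        refine (mul_le_mul_right (setLIntegral_cube_le (hΦ.comp measurable_prodMk_left)) _).trans ?_
        rw [← lintegral_const_mul' _ _ ENNReal.ofReal_ne_top]
        refine lintegral_mono_ae ?_
        filter_upwards [ae_cubeSurface_norm] with y hy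
        rw [← lintegral_const_mul' _ _ ENNReal.ofReal_ne_top]
        refine setLIntegral_mono' measurableSet_Ioo fun r hr => ?_
        have ht0 := ht.1.le
        have hr0 := hr.1.le
        simp only [Function.comp_apply, hR, inv_norm_smul_smul_eq hx ht.1,
          inv_norm_smul_smul_eq hy hr.1]
        rw [← ENNReal.ofReal_mul (by positivity), ← ENNReal.ofReal_mul (by positivity),
          ← ENNReal.ofReal_mul (by positivity), Real.rpow_neg (norm_nonneg _), div_eq_mul_inv]
        exact le_of_eq (congrArg _ (by ring))
    _ = ∫⁻ y, (∫⁻ t in Ioo (0 : ℝ) 1, ∫⁻ r in Ioo (0 : ℝ) 1,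
        ENNReal.ofReal (|f x - f y| ^ p) *
          ENNReal.ofReal (t ^ m * r ^ m * ‖t • x - r • y‖ ^ (-q))) ∂(cubeSurface m) :=
        lintegral_lintegral_swap hker.lintegral_prod_right'.aemeasurable
    _ ≤ _ := by
        rw [← lintegral_const_mul' _ _ hC]
        refine lintegral_mono_ae ?_
        filter_upwards [ae_cubeSurface_norm] with y hy
        simp_rw [lintegral_const_mul' _ _ (ENNReal.ofReal_ne_top (r := |f x - f y| ^ p))]
        rcases eq_or_ne x y with rfl | hxy
        · simp [Real.zero_rpow hp.ne']
        · refine (mul_le_mul_right (hK x y hx hy hxy) _).trans_eq ?_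
          rw [mul_left_comm, ← ENNReal.ofReal_mul (by positivity), div_eq_mul_inv,
            ← Real.rpow_neg (norm_nonneg _), neg_sub]

end

/-- boundedness of the cube radial extension `Tf(X) = f(X/‖X‖_∞)`
from `W^{s,p}(∂Q)` into `W^{s,p}(Q)` for `sp < n`, with explicit integral norms
(Hausdorff measure `μH[n-1]` on `∂Q`, Euclidean distances in the Gagliardo kernels). -/
theorem cube_radial_extension_bounded
    (n : ℕ) (hn : 2 ≤ n) (s p : ℝ) (hs0 : 0 < s) (hs1 : s < 1)
    (hp : 1 ≤ p) (hspn : s * p < n)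
    (Q : Set (EuclideanSpace ℝ (Fin n)))
    (hQ : Q = {X : EuclideanSpace ℝ (Fin n) | ∀ i, X i ∈ Set.Ioo (-1 : ℝ) 1})
    (T : (EuclideanSpace ℝ (Fin n) → ℝ) → EuclideanSpace ℝ (Fin n) → ℝ)
    (hT : ∀ g : EuclideanSpace ℝ (Fin n) → ℝ, ∀ Y : EuclideanSpace ℝ (Fin n),
      T g Y = g ((‖WithLp.equiv 2 (Fin n → ℝ) Y‖)⁻¹ • Y)) :
    ∃ C : ℝ, 0 < C ∧
      ∀ f : EuclideanSpace ℝ (Fin n) → ℝ, Measurable f →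
        (∫⁻ X in Q, ENNReal.ofReal (|T f X| ^ p))
        + (∫⁻ X in Q, ∫⁻ Y in Q,
            ENNReal.ofReal (|T f X - T f Y| ^ p / ‖X - Y‖ ^ ((n : ℝ) + s * p)))
        ≤ ENNReal.ofReal C *
          ((∫⁻ x in frontier Q, ENNReal.ofReal (|f x| ^ p) ∂μH[(n : ℝ) - 1])
           + ∫⁻ x in frontier Q, ∫⁻ y in frontier Q,
               ENNReal.ofReal (|f x - f y| ^ p / ‖x - y‖ ^ ((n : ℝ) - 1 + s * p))
             ∂μH[(n : ℝ) - 1] ∂μH[(n : ℝ) - 1]) := by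
  obtain ⟨m, rfl⟩ : ∃ m, n = m + 1 := ⟨n - 1, by omega⟩
  have hsp : 0 < s * p := mul_pos hs0 (by linarith)
  rw [show ((m + 1 : ℕ) : ℝ) - 1 = m by push_cast; ring]
  push_cast at hspn ⊢
  have hm : (0 : ℝ) ≤ m := Nat.cast_nonneg m
  obtain ⟨K, hK, hgag⟩ := lintegral_cube_radial_gagliardo_le m (p := p) (q := m + 1 + s * p)
    (by linarith) (by linarith) (by linarith)
  set c : ENNReal := (Fintype.card (Fin (m + 1) × ℤˣ) : ENNReal) with hc
  have hcfin : c ≠ ⊤ := ENNReal.natCast_ne_top _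
  have hle := cubeSurface_le m
  rw [← hQ, ← hc] at hle
  refine ⟨(c + K * (c * c)).toReal + 1, by positivity, fun f hf => ?_⟩
  have hTf : ∀ X, T f X = f ((‖WithLp.ofLp X‖)⁻¹ • X) := hT f
  have hCle : c + K * (c * c) ≤ ENNReal.ofReal ((c + K * (c * c)).toReal + 1) := by
    rw [← ENNReal.ofReal_toReal (a := c + K * (c * c)) (by finiteness)]
    exact ENNReal.ofReal_le_ofReal (by simp)
  have hLp := (lintegral_cube_radial_le m
    (g := fun x => ENNReal.ofReal (|f x| ^ p)) (by fun_prop)).trans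
      (lintegral_mono' hle le_rfl)
  have hG := (hgag f hf).trans (mul_le_mul_right
    (lintegral_mono' hle fun x => lintegral_mono' hle le_rfl) K)
  simp only [lintegral_smul_measure, smul_eq_mul, lintegral_const_mul' _ _ hcfin] at hLp hG
  rw [← hQ] at hLp hG
  simp only [hTf]
  rw [show (m : ℝ) + 1 + s * p - 1 = m + s * p by ring] at hG
  refine (add_le_add hLp hG).trans (le_trans ?_ (mul_le_mul_left hCle _))
  rw [mul_add, add_mul, add_mul, ← mul_assoc c c, ← mul_assoc K]
  exact add_le_add le_self_add le_add_self
end
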